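/- Consider the traffic flow model ∂ρ/∂t + v·∂ρ/∂x + ρ·∂v/∂x = 0 and ∂v/∂t − c·∂v/∂x = 0 on ℝ₊ × [0,1], with boundary conditions ρ(t,0) = h(q(t)/v(t,0)) and ∂v/∂t(t,1) = −μ(v(t,1) − f(ρ(t,1))), where c > 0, μ > 0, f ∈ C¹(ℝ₊) is positive, bounded and non-increasing, and h ∈ C²(ℝ₊) is non-decreasing with h(s) = s for s ∈ [0, ρ_max − ε] and h(s) = ρ_max for s ≥ ρ_max (ρ_max > 0, ε ∈ (0, ρ_max)). Let ρ_eq > 0 satisfy ρ_eq ≤ (c/(c + f(ρ_eq)))·(ρ_max − ε) and assume that (v − f(ρ_eq·(c + f(ρ_eq))/(c + v)))·(v − f(ρ_eq)) > 0 for all v ≥ 0 with v ≠ f(ρ_eq). Then there exists a function Q of class KL such that for every (ρ₀, v₀) in the state space X for which ρ₀(0) = ρ_eq·(c + f(ρ_eq))/(c + v₀(0)) and ρ₀′(0) = −(ρ₀(0)/(c + v₀(0)))·v₀′(0), the closed-loop system with the boundary feedback law q(t) = ρ_eq·v(t,0)·(c + f(ρ_eq))/(c + v(t,0)) and initial conditions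 ρ(0,·) = ρ₀, v(0,·) = v₀ admits a unique solution ρ, v ∈ C¹(ℝ₊ × [0,1]) with (ρ[t], v[t]) ∈ X for all t ≥ 0, satisfying for all t ≥ 0: max_{0≤x≤1}|ln(ρ(t,x)/ρ_eq)| + max_{0≤x≤1}|ln(v(t,x)/f(ρ_eq))| ≤ Q(max_{0≤x≤1}|ln(ρ₀(x)/ρ_eq)| + max_{0≤x≤1}|ln(v₀(x)/f(ρ_eq))|, t). -/

import Mathlib

open Set Filter

/-- Membership of a profile pair `(ρ, v)` in the state space `X`:
both profiles are `W^{2,∞}([0,1])` (i.e. `C¹` with Lipschitz derivative), positive,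
satisfy the outlet compatibility `c v'(1) = -μ (v(1) - f(ρ(1)))` and the inlet
compatibility `ρ(0) = h(a₁)`, `v(0) ρ'(0) + ρ(0) v'(0) = a₂ h'(a₁)` for some
`a₁ > 0`, `a₂ ∈ ℝ`. -/
def MemX (c μ : ℝ) (f h : ℝ → ℝ) (ρ v : ℝ → ℝ) : Prop :=
  ∃ ρ' v' : ℝ → ℝ,
    (∀ x ∈ Icc (0:ℝ) 1, HasDerivWithinAt ρ (ρ' x) (Icc 0 1) x) ∧
    (∀ x ∈ Icc (0:ℝ) 1, HasDerivWithinAt v (v' x) (Icc 0 1) x) ∧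
    (∃ L : NNReal, LipschitzOnWith L ρ' (Icc 0 1)) ∧
    (∃ L : NNReal, LipschitzOnWith L v' (Icc 0 1)) ∧
    (∀ x ∈ Icc (0:ℝ) 1, 0 < ρ x ∧ 0 < v x) ∧
    c * v' 1 = -μ * (v 1 - f (ρ 1)) ∧
    ∃ a₁ > (0:ℝ), ∃ a₂ : ℝ,
      ρ 0 = h a₁ ∧ v 0 * ρ' 0 + ρ 0 * v' 0 = a₂ * derivWithin h (Ici 0) a₁

/-- `(ρ, v)` (with continuous partial derivatives) is a classical `C¹` solution of the
closed-loop traffic flow model: conservation law `∂ρ/∂t + v ∂ρ/∂x + ρ ∂v/∂x = 0`,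
velocity equation `∂v/∂t - c ∂v/∂x = 0`, inlet condition `ρ(t,0) = h(q(t)/v(t,0))` with
the feedback `q(t) = ρeq v(t,0) (c + f ρeq)/(c + v(t,0))`, and dynamic outlet condition
`∂v/∂t(t,1) = -μ (v(t,1) - f(ρ(t,1)))`. -/
def IsSolCL (c μ ρeq : ℝ) (f h : ℝ → ℝ) (ρ v ρt ρx vt vx : ℝ → ℝ → ℝ) : Prop :=
  ContinuousOn (fun q : ℝ × ℝ => ρ q.1 q.2) (Ici 0 ×ˢ Icc 0 1) ∧
  ContinuousOn (fun q : ℝ × ℝ => v q.1 q.2) (Ici 0 ×ˢ Icc 0 1) ∧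
  ContinuousOn (fun q : ℝ × ℝ => ρt q.1 q.2) (Ici 0 ×ˢ Icc 0 1) ∧
  ContinuousOn (fun q : ℝ × ℝ => ρx q.1 q.2) (Ici 0 ×ˢ Icc 0 1) ∧
  ContinuousOn (fun q : ℝ × ℝ => vt q.1 q.2) (Ici 0 ×ˢ Icc 0 1) ∧
  ContinuousOn (fun q : ℝ × ℝ => vx q.1 q.2) (Ici 0 ×ˢ Icc 0 1) ∧
  (∀ t ∈ Ici (0:ℝ), ∀ x ∈ Icc (0:ℝ) 1,
    HasDerivWithinAt (fun s => ρ s x) (ρt t x) (Ici 0) t ∧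
    HasDerivWithinAt (fun y => ρ t y) (ρx t x) (Icc 0 1) x ∧
    HasDerivWithinAt (fun s => v s x) (vt t x) (Ici 0) t ∧
    HasDerivWithinAt (fun y => v t y) (vx t x) (Icc 0 1) x) ∧
  (∀ t ∈ Ici (0:ℝ), ∀ x ∈ Icc (0:ℝ) 1,
    ρt t x + v t x * ρx t x + ρ t x * vx t x = 0 ∧
    vt t x - c * vx t x = 0) ∧
  (∀ t ∈ Ici (0:ℝ),
    ρ t 0 = h ((ρeq * v t 0 * (c + f ρeq) / (c + v t 0)) / v t 0) ∧
    vt t 1 = -μ * (v t 1 - f (ρ t 1)))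

/-- `Q` is of class `KL`. -/
def IsKL (Q : ℝ → ℝ → ℝ) : Prop :=
  ContinuousOn (fun q : ℝ × ℝ => Q q.1 q.2) (Ici 0 ×ˢ Ici 0) ∧
  (∀ t ∈ Ici (0:ℝ), StrictMonoOn (fun s => Q s t) (Ici 0) ∧ Q 0 t = 0) ∧
  (∀ s ∈ Ici (0:ℝ), AntitoneOn (fun t => Q s t) (Ici 0) ∧
    Tendsto (fun t => Q s t) atTop (nhds 0))

/-- A set of triples `(m, t, N)` (size of the initial datum, time, size of the state) that is
uniformly bounded, uniformly stable and uniformly attracted to zero is dominated by a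
function of class `KL`. -/
theorem exists_isKL_of_uniform (D : Set (ℝ × ℝ × ℝ)) (hD : ∀ p ∈ D, 0 ≤ p.1)
    (hbdd : ∀ R, ∃ C, ∀ p ∈ D, p.1 ≤ R → p.2.2 ≤ C)
    (hstab : ∀ e > 0, ∃ δ > 0, ∀ p ∈ D, p.1 ≤ δ → p.2.2 ≤ e)
    (hattr : ∀ R, ∀ e > 0, ∃ T, ∀ p ∈ D, p.1 ≤ R → T ≤ p.2.1 → p.2.2 ≤ e) :
    ∃ Q : ℝ → ℝ → ℝ, IsKL Q ∧ ∀ p ∈ D, 0 ≤ p.2.1 → p.2.2 ≤ Q p.1 p.2.1 := by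
  set χ : ℝ → ℝ := fun r => max 0 (min 1 r) with hχ
  have χ0 : ∀ r, 0 ≤ χ r := fun r => le_max_left _ _
  have χ1 : ∀ r, χ r ≤ 1 := fun r => max_le zero_le_one (min_le_left _ _)
  have χmono : Monotone χ := fun a b hab => max_le_max le_rfl (min_le_min le_rfl hab)
  have χlip : ∀ a b, |χ a - χ b| ≤ |a - b| := by
    intro a b
    simp only [hχ]
    grind
  have χneg : ∀ r, r ≤ 0 → χ r = 0 := fun r hr => by simp only [hχ]; grind
  have χbig : ∀ r, 1 ≤ r → χ r = 1 := fun r hr => by simp only [hχ]; grind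
  set g : ℝ → ℝ → ℝ × ℝ × ℝ → ℝ := fun s t p =>
    max 0 p.2.2 * (χ (2 - p.1 / s) * χ (1 + p.2.1 - t)) with hg
  have g0 : ∀ s t p, 0 ≤ g s t p := fun s t p =>
    mul_nonneg (le_max_left _ _) (mul_nonneg (χ0 _) (χ0 _))
  have gle : ∀ s t p, g s t p ≤ max 0 p.2.2 := fun s t p =>
    mul_le_of_le_one_right (le_max_left _ _) (mul_le_one₀ (χ1 _) (χ0 _) (χ1 _))
  have gzero : ∀ s > 0, ∀ t p, 2 * s ≤ p.1 → g s t p = 0 := by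
    intro s hs t p hp
    have : χ (2 - p.1 / s) = 0 := χneg _ (by rw [sub_nonpos, le_div_iff₀ hs]; exact hp)
    simp [hg, this]
  have gzero' : ∀ s t p, p.2.1 ≤ t - 1 → g s t p = 0 := by
    intro s t p hp
    have : χ (1 + p.2.1 - t) = 0 := χneg _ (by linarith)
    simp [hg, this]
  set S : ℝ → ℝ → Set ℝ := fun s t => insert 0 (g s t '' D) with hS
  set q : ℝ → ℝ → ℝ := fun s t => sSup (S s t) with hq
  have Sne : ∀ s t, (S s t).Nonempty := fun s t => ⟨0, mem_insert _ _⟩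
  have Sbdd : ∀ s > 0, ∀ t, BddAbove (S s t) := by
    intro s hs t
    obtain ⟨C, hC⟩ := hbdd (2 * s)
    refine ⟨max 0 C, ?_⟩
    rintro _ (rfl | ⟨p, hp, rfl⟩)
    · exact le_max_left _ _
    · rcases le_total (2 * s) p.1 with h1 | h1
      · rw [gzero s hs t p h1]; exact le_max_left _ _
      · exact (gle s t p).trans (max_le_max le_rfl (hC p hp h1))
  have q0 : ∀ s > 0, ∀ t, 0 ≤ q s t := fun s hs t => le_csSup (Sbdd s hs t) (mem_insert _ _)
  have gq : ∀ s > 0, ∀ t, ∀ p ∈ D, g s t p ≤ q s t := fun s hs t p hp =>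
    le_csSup (Sbdd s hs t) (mem_insert_of_mem _ ⟨p, hp, rfl⟩)
  have qle : ∀ s t b, 0 ≤ b → (∀ p ∈ D, g s t p ≤ b) → q s t ≤ b := by
    intro s t b hb H
    refine csSup_le (Sne s t) ?_
    rintro _ (rfl | ⟨p, hp, rfl⟩)
    exacts [hb, H p hp]
  have qmono : ∀ s s' t, 0 < s → s ≤ s' → q s t ≤ q s' t := by
    intro s s' t hs hss
    have hs' : 0 < s' := hs.trans_le hss
    refine qle _ _ _ (q0 s' hs' t) fun p hp => ?_
    refine le_trans ?_ (gq s' hs' t p hp)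
    refine mul_le_mul_of_nonneg_left (mul_le_mul_of_nonneg_right (χmono ?_) (χ0 _))
      (le_max_left _ _)
    have := div_le_div_of_nonneg_left (hD p hp) hs hss
    linarith
  have qanti : ∀ s > 0, ∀ t t', t ≤ t' → q s t' ≤ q s t := by
    intro s hs t t' htt
    refine qle _ _ _ (q0 s hs t) fun p hp => le_trans ?_ (gq s hs t p hp)
    refine mul_le_mul_of_nonneg_left (mul_le_mul_of_nonneg_left (χmono ?_) (χ0 _))
      (le_max_left _ _)
    linarith
  have qlim : ∀ s > 0, Tendsto (fun t => q s t) atTop (nhds 0) := by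
    intro s hs
    rw [Metric.tendsto_atTop]
    intro e he
    obtain ⟨T, hT⟩ := hattr (2 * s) (e / 2) (by linarith)
    refine ⟨T + 1, fun t ht => ?_⟩
    rw [Real.dist_eq, sub_zero, abs_of_nonneg (q0 s hs t)]
    refine lt_of_le_of_lt (qle s t (e / 2) (by linarith) fun p hp => ?_) (by linarith)
    rcases le_total (2 * s) p.1 with h1 | h1
    · rw [gzero s hs t p h1]; linarith
    · rcases le_total p.2.1 (t - 1) with h2 | h2
      · rw [gzero' s t p h2]; linarith
      · exact (gle s t p).trans (max_le (by linarith) (hT p hp h1 (by linarith)))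
  have qsmall : ∀ e > 0, ∃ δ > 0, ∀ s, 0 < s → s ≤ δ → ∀ t, q s t ≤ e := by
    intro e he
    obtain ⟨δ, hδ, H⟩ := hstab e he
    refine ⟨δ / 2, by linarith, fun s hs hsδ t => qle s t e he.le fun p hp => ?_⟩
    rcases le_total (2 * s) p.1 with h1 | h1
    · rw [gzero s hs t p h1]; exact he.le
    · exact (gle s t p).trans (max_le he.le (H p hp (by linarith)))
  have gdiff : ∀ s₀ > 0, ∃ C ≥ 0, ∀ s s' t t', 0 < s → s ≤ s₀ → 0 < s' → s' ≤ s₀ →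
      ∀ p ∈ D, g s t p ≤ g s' t' p + C * (|1 / s - 1 / s'| + |t - t'|) := by
    intro s₀ hs₀
    obtain ⟨B, hB⟩ := hbdd (2 * s₀)
    refine ⟨max 0 B * (2 * s₀ + 1), by positivity, ?_⟩
    intro s s' t t' hs hs1 hs' hs1' p hp
    have hp0 := hD p hp
    have hr : 0 ≤ max 0 B * (2 * s₀ + 1) * (|1 / s - 1 / s'| + |t - t'|) := by positivity
    rcases le_total (2 * s₀) p.1 with h1 | h1
    · rw [gzero s hs t p (by linarith)]
      have := g0 s' t' p
      linarith
    · have hN : max 0 p.2.2 ≤ max 0 B := max_le_max le_rfl (hB p hp h1)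
      have hN0 : 0 ≤ max 0 p.2.2 := le_max_left _ _
      have e1 : |χ (2 - p.1 / s) - χ (2 - p.1 / s')| ≤ 2 * s₀ * |1 / s - 1 / s'| := by
        refine (χlip _ _).trans ?_
        have : 2 - p.1 / s - (2 - p.1 / s') = -(p.1 * (1 / s - 1 / s')) := by ring
        rw [this, abs_neg, abs_mul, abs_of_nonneg hp0]
        exact mul_le_mul_of_nonneg_right h1 (abs_nonneg _)
      have e2 : |χ (1 + p.2.1 - t) - χ (1 + p.2.1 - t')| ≤ |t - t'| := by
        refine (χlip _ _).trans (le_of_eq ?_)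
        rw [show 1 + p.2.1 - t - (1 + p.2.1 - t') = -(t - t') by ring, abs_neg]
      have e3 : χ (2 - p.1 / s) * χ (1 + p.2.1 - t) ≤ χ (2 - p.1 / s') * χ (1 + p.2.1 - t')
          + (2 * s₀ + 1) * (|1 / s - 1 / s'| + |t - t'|) := by
        have a1 := χ0 (2 - p.1 / s'); have a2 := χ1 (2 - p.1 / s')
        have a3 := χ0 (1 + p.2.1 - t); have a4 := χ1 (1 + p.2.1 - t)
        have b1 := (abs_le.1 e1).2
        have b2 := (abs_le.1 e2).2
        have b3 := abs_nonneg (1 / s - 1 / s')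
        have b4 := abs_nonneg (t - t')
        have c1 : (χ (2 - p.1 / s) - χ (2 - p.1 / s')) * χ (1 + p.2.1 - t)
            ≤ 2 * s₀ * |1 / s - 1 / s'| :=
          (mul_le_mul_of_nonneg_right b1 a3).trans
            (mul_le_of_le_one_right (by positivity) a4)
        have c2 : χ (2 - p.1 / s') * (χ (1 + p.2.1 - t) - χ (1 + p.2.1 - t')) ≤ |t - t'| :=
          (mul_le_mul_of_nonneg_left b2 a1).trans (mul_le_of_le_one_left b4 a2)
        have c3 : 0 ≤ s₀ * |t - t'| := by positivity
        nlinarith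
      calc g s t p ≤ max 0 p.2.2 * (χ (2 - p.1 / s') * χ (1 + p.2.1 - t')
          + (2 * s₀ + 1) * (|1 / s - 1 / s'| + |t - t'|)) := mul_le_mul_of_nonneg_left e3 hN0
        _ = g s' t' p + max 0 p.2.2 * ((2 * s₀ + 1) * (|1 / s - 1 / s'| + |t - t'|)) := by
          simp only [hg]; ring
        _ ≤ g s' t' p + max 0 B * ((2 * s₀ + 1) * (|1 / s - 1 / s'| + |t - t'|)) := by
          gcongr
        _ = _ := by ring
  have qdiff : ∀ s₀ > 0, ∃ C ≥ 0, ∀ s s' t t', 0 < s → s ≤ s₀ → 0 < s' → s' ≤ s₀ →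
      |q s t - q s' t'| ≤ C * (|1 / s - 1 / s'| + |t - t'|) := by
    intro s₀ hs₀
    obtain ⟨C, hC, H⟩ := gdiff s₀ hs₀
    have key : ∀ s s' t t', 0 < s → s ≤ s₀ → 0 < s' → s' ≤ s₀ →
        q s t ≤ q s' t' + C * (|1 / s - 1 / s'| + |t - t'|) := by
      intro s s' t t' hs hs1 hs' hs1'
      refine qle _ _ _ (add_nonneg (q0 _ hs' _) (by positivity)) fun p hp => ?_
      exact (H s s' t t' hs hs1 hs' hs1' p hp).trans (by linarith [gq s' hs' t' p hp])
    refine ⟨C, hC, fun s s' t t' hs hs1 hs' hs1' => abs_le.2 ⟨?_, ?_⟩⟩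
    · have := key s' s t' t hs' hs1' hs hs1
      rw [abs_sub_comm (1 / s') (1 / s), abs_sub_comm t' t] at this
      linarith
    · linarith [key s s' t t' hs hs1 hs' hs1']
  set Q : ℝ → ℝ → ℝ := fun s t => (if s ≤ 0 then 0 else q s t) + s * Real.exp (-t) with hQ
  have Qpos : ∀ s > 0, ∀ t, Q s t = q s t + s * Real.exp (-t) := by
    intro s hs t
    simp only [hQ, if_neg (not_le.2 hs)]
  have Qzero : ∀ t, Q 0 t = 0 := fun t => by simp [hQ]
  refine ⟨Q, ⟨?_, fun t ht => ⟨?_, Qzero t⟩, fun s hs => ⟨?_, ?_⟩⟩, ?_⟩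
  · refine ContinuousOn.add ?_ (by fun_prop)
    rintro ⟨s₁, t₁⟩ ⟨hs₁, ht₁⟩
    rcases (show (0:ℝ) ≤ s₁ from hs₁).eq_or_lt with h1 | h1
    · subst h1
      rw [Metric.continuousWithinAt_iff]
      intro e he
      obtain ⟨δ, hδ, H⟩ := qsmall (e / 2) (by linarith)
      refine ⟨δ, hδ, ?_⟩
      rintro ⟨s, t⟩ ⟨hs, -⟩ hd
      have hsδ : |s - 0| < δ := lt_of_le_of_lt (le_max_left _ _) hd
      rw [sub_zero] at hsδ
      rw [Real.dist_eq]
      simp only [le_refl, if_true, sub_zero]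
      split_ifs with h2
      · simpa using he
      · rw [abs_of_nonneg (q0 s (not_le.1 h2) t)]
        have := H s (not_le.1 h2) ((le_abs_self _).trans hsδ.le) t
        linarith
    · apply ContinuousAt.continuousWithinAt
      obtain ⟨C, hC, H⟩ := qdiff (2 * s₁) (by linarith)
      rw [ContinuousAt, tendsto_iff_dist_tendsto_zero]
      have hlim : Tendsto (fun x : ℝ × ℝ => C * (|1 / x.1 - 1 / s₁| + |x.2 - t₁|))
          (nhds (s₁, t₁)) (nhds 0) := by
        have : ContinuousAt (fun x : ℝ × ℝ => C * (|1 / x.1 - 1 / s₁| + |x.2 - t₁|)) (s₁, t₁) := by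
          have : (s₁, t₁).1 ≠ 0 := h1.ne'
          fun_prop (disch := assumption)
        simpa [ContinuousAt] using this
      refine squeeze_zero' (Eventually.of_forall fun _ => dist_nonneg) ?_ hlim
      have hev : ∀ᶠ x : ℝ × ℝ in nhds (s₁, t₁), x.1 ∈ Ioo 0 (2 * s₁) :=
        continuous_fst.continuousAt.eventually (Ioo_mem_nhds h1 (by linarith))
      filter_upwards [hev] with x hx
      rw [Real.dist_eq, if_neg (not_le.2 hx.1), if_neg (not_le.2 h1)]
      exact H x.1 s₁ x.2 t₁ hx.1 hx.2.le h1 (by linarith)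
  · intro s hs s' hs' hss
    have hs'0 : 0 < s' := lt_of_le_of_lt hs hss
    have he := Real.exp_pos (-t)
    rcases (show (0:ℝ) ≤ s from hs).eq_or_lt with h1 | h1
    · subst h1
      show Q 0 t < Q s' t
      rw [Qzero, Qpos s' hs'0]
      have := q0 s' hs'0 t
      positivity
    · show Q s t < Q s' t
      rw [Qpos s h1, Qpos s' hs'0]
      have := qmono s s' t h1 hss.le
      have := mul_lt_mul_of_pos_right hss he
      linarith
  · intro t ht t' ht' htt
    rcases (show (0:ℝ) ≤ s from hs).eq_or_lt with h1 | h1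
    · subst h1
      simp only [Qzero, le_refl]
    · simp only [Qpos s h1]
      exact add_le_add (qanti s h1 t t' htt)
        (mul_le_mul_of_nonneg_left (Real.exp_le_exp.2 (by linarith)) h1.le)
  · rcases (show (0:ℝ) ≤ s from hs).eq_or_lt with h1 | h1
    · subst h1
      simp only [Qzero]
      exact tendsto_const_nhds
    · simp only [Qpos s h1]
      have := (qlim s h1).add ((Real.tendsto_exp_neg_atTop_nhds_zero).const_mul s)
      simpa using this
  · intro p hp ht
    rcases (hD p hp).eq_or_lt with h1 | h1
    · rw [← h1, Qzero]
      refine le_of_forall_pos_le_add fun e he => ?_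
      obtain ⟨δ, hδ, H⟩ := hstab e he
      have := H p hp (by linarith)
      linarith
    · rw [Qpos _ h1]
      have e1 : g p.1 p.2.1 p = max 0 p.2.2 := by
        simp only [hg]
        rw [χbig (2 - p.1 / p.1) (by rw [div_self h1.ne']; norm_num), χbig _ (by linarith)]
        ring
      have := gq p.1 h1 p.2.1 p hp
      have := le_max_right 0 p.2.2
      have : 0 ≤ p.1 * Real.exp (-p.2.1) := by positivity
      linarith

theorem nonneg_deriv_of_le_left {g : ℝ → ℝ} {g' a x : ℝ} {S : Set ℝ} (hax : a < x)
    (hS : Icc a x ⊆ S) (hg : HasDerivWithinAt g g' S x) (hm : ∀ y ∈ Icc a x, g y ≤ g x) :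
    0 ≤ g' := by
  have h1 := (hg.mono hS).mono (Ico_subset_Icc_self)
  rw [hasDerivWithinAt_iff_tendsto_slope' (by simp)] at h1
  have : (nhdsWithin x (Ico a x)).NeBot := by
    rw [nhdsWithin_Ico_eq_nhdsLT hax]; infer_instance
  refine ge_of_tendsto h1 ?_
  filter_upwards [self_mem_nhdsWithin] with y hy
  rw [slope_def_field]
  exact div_nonneg_of_nonpos (sub_nonpos.2 (hm y (Ico_subset_Icc_self hy)))
    (sub_nonpos.2 hy.2.le)

theorem nonpos_deriv_of_le_right {g : ℝ → ℝ} {g' b x : ℝ} {S : Set ℝ} (hxb : x < b)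
    (hS : Icc x b ⊆ S) (hg : HasDerivWithinAt g g' S x) (hm : ∀ y ∈ Icc x b, g y ≤ g x) :
    g' ≤ 0 := by
  have h1 := (hg.mono hS).mono (Ioc_subset_Icc_self)
  rw [hasDerivWithinAt_iff_tendsto_slope' (by simp)] at h1
  have : (nhdsWithin x (Ioc x b)).NeBot := by
    rw [nhdsWithin_Ioc_eq_nhdsGT hxb]; infer_instance
  refine le_of_tendsto h1 ?_
  filter_upwards [self_mem_nhdsWithin] with y hy
  rw [slope_def_field]
  exact div_nonpos_of_nonpos_of_nonneg (sub_nonpos.2 (hm y (Ioc_subset_Icc_self hy)))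
    (sub_nonneg.2 hy.1.le)

/-- A comparison principle for first-order problems on `[0, τ] × [0, 1]`. -/
theorem le_of_transport {u ut ux : ℝ → ℝ → ℝ} {τ a : ℝ}
    (hcont : ContinuousOn (fun q : ℝ × ℝ => u q.1 q.2) (Icc 0 τ ×ˢ Icc 0 1))
    (ht : ∀ t ∈ Icc 0 τ, ∀ x ∈ Icc (0:ℝ) 1, HasDerivWithinAt (fun s => u s x) (ut t x) (Ici 0) t)
    (hx : ∀ t ∈ Icc 0 τ, ∀ x ∈ Icc (0:ℝ) 1,
      HasDerivWithinAt (fun y => u t y) (ux t x) (Icc 0 1) x)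
    (hinit : ∀ x ∈ Icc (0:ℝ) 1, a ≤ u 0 x)
    (hstep : ∀ t ∈ Ioc 0 τ, ∀ x ∈ Icc (0:ℝ) 1, u t x < a → (x < 1 → 0 ≤ ux t x) →
      (0 < x → ux t x ≤ 0) → 0 ≤ ut t x) :
    ∀ t ∈ Icc 0 τ, ∀ x ∈ Icc (0:ℝ) 1, a ≤ u t x := by
  intro t₁ ht₁ x₁ hx₁
  by_contra! hlt
  obtain ⟨δ, hδ, hδt⟩ : ∃ δ > 0, u t₁ x₁ + δ * t₁ < a := by
    refine ⟨(a - u t₁ x₁) / (2 * (t₁ + 1)), div_pos (by linarith) (by linarith [ht₁.1]), ?_⟩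
    have h1 : 0 ≤ t₁ := ht₁.1
    have : (a - u t₁ x₁) / (2 * (t₁ + 1)) * t₁ < a - u t₁ x₁ := by
      rw [div_mul_eq_mul_div, div_lt_iff₀ (by linarith)]
      nlinarith
    linarith
  obtain ⟨⟨t, x⟩, ⟨htx, hxx⟩, hmin⟩ := (isCompact_Icc.prod isCompact_Icc).exists_isMinOn
    ⟨(t₁, x₁), ht₁, hx₁⟩ (hcont.add (f := fun q : ℝ × ℝ => u q.1 q.2) (g := fun q => δ * q.1)
      (by fun_prop))
  have hmin' : ∀ s ∈ Icc 0 τ, ∀ y ∈ Icc (0:ℝ) 1, u t x + δ * t ≤ u s y + δ * s :=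
    fun s hs y hy => hmin (show (s, y) ∈ Icc 0 τ ×ˢ Icc (0:ℝ) 1 from ⟨hs, hy⟩)
  dsimp only at htx hxx
  have hval : u t x + δ * t < a := (hmin' t₁ ht₁ x₁ hx₁).trans_lt hδt
  have ht0 : 0 < t := by
    rcases htx.1.eq_or_lt with h | h
    · subst h
      have := hinit x hxx
      linarith
    · exact h
  have hd : 0 ≤ -(ut t x + δ) := by
    have h1 : HasDerivWithinAt (fun s => -(u s x + δ * s)) (-(ut t x + δ)) (Ici 0) t := by
      have := ((ht t htx x hxx).add ((hasDerivWithinAt_id t _).const_mul δ)).neg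
      rw [mul_one] at this
      exact this
    refine nonneg_deriv_of_le_left ht0 Icc_subset_Ici_self h1 fun y hy => ?_
    linarith [hmin' y ⟨hy.1, hy.2.trans htx.2⟩ x hxx]
  have := hstep t ⟨ht0, htx.2⟩ x hxx (by nlinarith) ?_ ?_
  · linarith
  · intro h
    have := nonpos_deriv_of_le_right h (Icc_subset_Icc_left hxx.1) (hx t htx x hxx).neg
      fun y hy => by simp only [Pi.neg_apply]; linarith [hmin' t htx y ⟨hxx.1.trans hy.1, hy.2⟩]
    linarith
  · intro h
    have := nonneg_deriv_of_le_left h (Icc_subset_Icc_right hxx.2) (hx t htx x hxx).neg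
      fun y hy => by simp only [Pi.neg_apply]; linarith [hmin' t htx y ⟨hy.1, hy.2.trans hxx.2⟩]
    linarith

section Solutions

variable {c μ ρmax ε ρeq : ℝ} {f h : ℝ → ℝ} {ρ v ρt ρx vt vx : ℝ → ℝ → ℝ}

theorem inlet_density_lt (hc : 0 < c) (hw : 0 < f ρeq) (hρeq : 0 < ρeq)
    (heq : ρeq ≤ c / (c + f ρeq) * (ρmax - ε)) {u : ℝ} (hu : 0 < u) :
    ρeq * (c + f ρeq) / (c + u) < ρmax - ε := by
  have h1 : ρeq * (c + f ρeq) ≤ c * (ρmax - ε) := by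
    rw [div_mul_eq_mul_div, le_div_iff₀ (by linarith)] at heq
    exact heq
  have h2 : 0 < ρeq * (c + f ρeq) := by positivity
  have h3 : 0 < ρmax - ε := by
    by_contra! h3
    nlinarith
  rw [div_lt_iff₀ (by linarith)]
  nlinarith

theorem feedback_flow_eq (hc : 0 < c) (hw : 0 < f ρeq) (hρeq : 0 < ρeq)
    (hhid : ∀ s ∈ Icc (0:ℝ) (ρmax - ε), h s = s)
    (heq : ρeq ≤ c / (c + f ρeq) * (ρmax - ε)) {u : ℝ} (hu : 0 < u) :
    h ((ρeq * u * (c + f ρeq) / (c + u)) / u) = ρeq * (c + f ρeq) / (c + u) := by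
  have h1 : (ρeq * u * (c + f ρeq) / (c + u)) / u = ρeq * (c + f ρeq) / (c + u) := by
    field_simp
  rw [h1, hhid]
  exact ⟨by positivity, (inlet_density_lt hc hw hρeq heq hu).le⟩

/-- The Riemann invariant `ρ (c + v)` is transported with velocity `v`. -/
theorem invariant_transport (hsol : IsSolCL c μ ρeq f h ρ v ρt ρx vt vx) {t x : ℝ} (ht : 0 ≤ t)
    (hx : x ∈ Icc (0:ℝ) 1) :
    (ρt t x * (c + v t x) + ρ t x * vt t x) +
      v t x * (ρx t x * (c + v t x) + ρ t x * vx t x) = 0 := by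
  obtain ⟨-, -, -, -, -, -, -, hpde, -⟩ := hsol
  obtain ⟨h1, h2⟩ := hpde t ht x hx
  linear_combination (c + v t x) * h1 + ρ t x * h2

theorem invariant_hasDeriv (hsol : IsSolCL c μ ρeq f h ρ v ρt ρx vt vx) {t x : ℝ} (ht : 0 ≤ t)
    (hx : x ∈ Icc (0:ℝ) 1) :
    HasDerivWithinAt (fun s => ρ s x * (c + v s x))
      (ρt t x * (c + v t x) + ρ t x * vt t x) (Ici 0) t ∧
    HasDerivWithinAt (fun y => ρ t y * (c + v t y))
      (ρx t x * (c + v t x) + ρ t x * vx t x) (Icc 0 1) x := by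
  obtain ⟨-, -, -, -, -, -, hder, -, -⟩ := hsol
  obtain ⟨h1, h2, h3, h4⟩ := hder t ht x hx
  exact ⟨h1.mul (h3.const_add c), h2.mul (h4.const_add c)⟩

theorem IsSolCL.pos (hc : 0 < c) (hμ : 0 < μ) (hρeq : 0 < ρeq)
    (hfpos : ∀ x ∈ Ici (0:ℝ), 0 < f x) (hfanti : AntitoneOn f (Ici 0))
    (hhid : ∀ s ∈ Icc (0:ℝ) (ρmax - ε), h s = s)
    (heq : ρeq ≤ c / (c + f ρeq) * (ρmax - ε))
    (hsol : IsSolCL c μ ρeq f h ρ v ρt ρx vt vx)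
    (hinit : ∀ x ∈ Icc (0:ℝ) 1, 0 < ρ 0 x ∧ 0 < v 0 x) :
    ∀ t ∈ Ici (0:ℝ), ∀ x ∈ Icc (0:ℝ) 1, 0 < ρ t x ∧ 0 < v t x := by
  have hsol' := hsol
  obtain ⟨cρ, cv, -, -, -, -, hder, hpde, hbc⟩ := hsol'
  have hw : 0 < f ρeq := hfpos _ hρeq.le
  by_contra! hbad
  obtain ⟨T, hT, X, hX, hTX⟩ := hbad
  have hT0 : (0:ℝ) ≤ T := hT
  have hsub : Icc 0 T ×ˢ Icc (0:ℝ) 1 ⊆ Ici 0 ×ˢ Icc 0 1 :=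
    prod_mono Icc_subset_Ici_self le_rfl
  have hcmp : IsCompact (Icc 0 T ×ˢ Icc (0:ℝ) 1) := isCompact_Icc.prod isCompact_Icc
  have hm : ContinuousOn (fun q : ℝ × ℝ => min (ρ q.1 q.2) (v q.1 q.2))
      (Icc 0 T ×ˢ Icc (0:ℝ) 1) := continuous_min.comp_continuousOn
      ((cρ.mono hsub).prodMk (cv.mono hsub))
  have hBc : IsCompact ((Icc 0 T ×ˢ Icc (0:ℝ) 1) ∩
      (fun q : ℝ × ℝ => min (ρ q.1 q.2) (v q.1 q.2)) ⁻¹' Iic 0) :=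
    hcmp.of_isClosed_subset (hm.preimage_isClosed_of_isClosed hcmp.isClosed isClosed_Iic)
      inter_subset_left
  obtain ⟨⟨τ, ξ⟩, ⟨⟨hτ, hξ⟩, hle⟩, hmin⟩ := hBc.exists_isMinOn
    ⟨(T, X), ⟨⟨hT, le_rfl⟩, hX⟩, by
      simp only [mem_preimage, mem_Iic, min_le_iff]
      by_contra! hh
      exact absurd (hTX hh.1) (not_le.2 hh.2)⟩ continuous_fst.continuousOn
  dsimp only at hτ hξ
  simp only [mem_preimage, mem_Iic, min_le_iff] at hle
  have hbefore : ∀ s, 0 ≤ s → s < τ → ∀ x ∈ Icc (0:ℝ) 1, 0 < ρ s x ∧ 0 < v s x := by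
    intro s hs hsτ x hx
    by_contra hh
    have : τ ≤ s := hmin (show (s, x) ∈ _ from ⟨⟨⟨hs, hsτ.le.trans hτ.2⟩, hx⟩, by
      simp only [mem_preimage, mem_Iic, min_le_iff]
      by_contra! h2
      exact hh h2⟩)
    linarith
  have hτ0 : 0 < τ := by
    rcases hτ.1.eq_or_lt with h1 | h1
    · subst h1
      have := hinit ξ hξ
      rcases hle with h2 | h2 <;> linarith
    · exact h1
  have hsubτ : Icc 0 τ ×ˢ Icc (0:ℝ) 1 ⊆ Ici 0 ×ˢ Icc 0 1 :=
    prod_mono Icc_subset_Ici_self le_rfl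
  have hcmpτ : IsCompact (Icc 0 τ ×ˢ Icc (0:ℝ) 1) := isCompact_Icc.prod isCompact_Icc
  have hρnn : ∀ s ∈ Icc 0 τ, ∀ x ∈ Icc (0:ℝ) 1, 0 ≤ ρ s x := by
    intro s hs x hx
    rcases hs.2.eq_or_lt with h1 | h1
    · subst h1
      have hcw := ((hder s hτ.1 x hx).1.continuousWithinAt).continuousAt (Ici_mem_nhds hτ0)
      refine ge_of_tendsto (hcw.tendsto.mono_left (nhdsWithin_le_nhds (s := Iio s))) ?_
      filter_upwards [Ioo_mem_nhdsLT hτ0] with y hy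
      exact (hbefore y hy.1.le hy.2 x hx).1.le
    · exact (hbefore s hs.1 h1 x hx).1.le
  obtain ⟨R, hR⟩ := (hcmpτ.image_of_continuousOn (cρ.mono hsubτ)).bddAbove
  have hR' : ∀ s ∈ Icc 0 τ, ∀ x ∈ Icc (0:ℝ) 1, ρ s x ≤ R := fun s hs x hx =>
    hR ⟨(s, x), ⟨hs, hx⟩, rfl⟩
  have hmin0 : ∀ {u : ℝ → ℝ}, ContinuousOn u (Icc 0 1) → (∀ x ∈ Icc (0:ℝ) 1, 0 < u x) →
      ∃ a > 0, ∀ x ∈ Icc (0:ℝ) 1, a ≤ u x := by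
    intro u hu hpos
    obtain ⟨x, hx, hmx⟩ := isCompact_Icc.exists_isMinOn ⟨0, by simp⟩ hu
    exact ⟨u x, hpos x hx, fun y hy => hmx hy⟩
  have hR0 : 0 ≤ R := (hρnn 0 ⟨le_rfl, hτ0.le⟩ 0 (by simp)).trans
    (hR' 0 ⟨le_rfl, hτ0.le⟩ 0 (by simp))
  have hvpos : ∀ s ∈ Icc 0 τ, ∀ x ∈ Icc (0:ℝ) 1, 0 < v s x := by
    obtain ⟨a, ha, hav⟩ := hmin0 (u := fun x => v 0 x)
      (fun x hx => (hder 0 (by simp) x hx).2.2.2.continuousWithinAt) (fun x hx => (hinit x hx).2)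
    have := le_of_transport (u := v) (ut := vt) (ux := vx) (τ := τ) (a := min a (f R))
      (cv.mono hsubτ) (fun t ht x hx => (hder t ht.1 x hx).2.2.1)
      (fun t ht x hx => (hder t ht.1 x hx).2.2.2) (fun x hx => (min_le_left _ _).trans (hav x hx)) ?_
    · exact fun s hs x hx => (lt_min ha (hfpos R hR0)).trans_le (this s hs x hx)
    · intro t ht x hx hlt h1 h2
      rcases hx.2.eq_or_lt with h3 | h3
      · subst h3
        rw [(hbc t ht.1.le).2]
        have h4 : f R ≤ f (ρ t 1) := hfanti (hρnn t ⟨ht.1.le, ht.2⟩ 1 hx) hR0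
          (hR' t ⟨ht.1.le, ht.2⟩ 1 hx)
        have h5 := hlt.trans_le (min_le_right _ _)
        nlinarith
      · have := (hpde t ht.1.le x hx).2
        have := mul_nonneg hc.le (h1 h3)
        linarith
  have hzpos : ∀ s ∈ Icc 0 τ, ∀ x ∈ Icc (0:ℝ) 1, 0 < ρ s x * (c + v s x) := by
    have hK : 0 < ρeq * (c + f ρeq) := by positivity
    obtain ⟨a, ha, haz⟩ := hmin0 (u := fun x => ρ 0 x * (c + v 0 x))
      (fun x hx => (invariant_hasDeriv hsol le_rfl hx).2.continuousWithinAt)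
      (fun x hx => mul_pos (hinit x hx).1 (by linarith [(hinit x hx).2]))
    have := le_of_transport (u := fun t x => ρ t x * (c + v t x))
      (ut := fun t x => ρt t x * (c + v t x) + ρ t x * vt t x)
      (ux := fun t x => ρx t x * (c + v t x) + ρ t x * vx t x) (τ := τ)
      (a := min a (ρeq * (c + f ρeq)))
      ((cρ.mul (continuousOn_const.add cv)).mono hsubτ)
      (fun t ht x hx => (invariant_hasDeriv hsol ht.1 hx).1)
      (fun t ht x hx => (invariant_hasDeriv hsol ht.1 hx).2)
      (fun x hx => (min_le_left _ _).trans (haz x hx)) ?_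
    · exact fun s hs x hx => (lt_min ha hK).trans_le (this s hs x hx)
    · intro t ht x hx hlt h1 h2
      have hv := hvpos t ⟨ht.1.le, ht.2⟩ x hx
      rcases hx.1.eq_or_lt with h3 | h3
      · subst h3
        have h5 := hlt.trans_le (min_le_right _ _)
        rw [(hbc t ht.1.le).1, feedback_flow_eq hc hw hρeq hhid heq hv,
          div_mul_cancel₀ _ (by linarith)] at h5
        exact absurd h5 (lt_irrefl _)
      · have := invariant_transport hsol ht.1.le hx
        have := mul_nonpos_of_nonneg_of_nonpos hv.le (h2 h3)
        linarith
  have h1 := hvpos τ ⟨hτ.1, le_rfl⟩ ξ hξ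
  have h2 := pos_of_mul_pos_left (hzpos τ ⟨hτ.1, le_rfl⟩ ξ hξ) (by linarith)
  rcases hle with h3 | h3 <;> linarith

end Solutions

section Uniqueness

variable {c μ ρmax ε ρeq : ℝ} {f h : ℝ → ℝ} {ρ₁ v₁ ρt₁ ρx₁ vt₁ vx₁ : ℝ → ℝ → ℝ}
  {ρ₂ v₂ ρt₂ ρx₂ vt₂ vx₂ : ℝ → ℝ → ℝ}

/-- First-order conditions at a positive maximum of an exponentially weighted function. -/
theorem weighted_max_conditions {u ut ux : ℝ → ℝ → ℝ} {T t x l M : ℝ}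
    (hM : 0 < M) (ht : t ∈ Icc 0 T) (hx : x ∈ Icc (0:ℝ) 1)
    (hut : HasDerivWithinAt (fun s => u s x) (ut t x) (Ici 0) t)
    (hux : HasDerivWithinAt (fun y => u t y) (ux t x) (Icc 0 1) x)
    (hinit : u 0 x = 0)
    (hmax : ∀ s ∈ Icc 0 T, ∀ y ∈ Icc (0:ℝ) 1, u s y ≤ M * Real.exp (l * s))
    (hval : u t x = M * Real.exp (l * t)) :
    0 < t ∧ l * u t x ≤ ut t x ∧ (x < 1 → ux t x ≤ 0) ∧ (0 < x → 0 ≤ ux t x) := by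
  have ht0 : 0 < t := by
    rcases ht.1.eq_or_lt with h | h
    · subst h
      have := Real.exp_pos (l * 0)
      have : 0 < M * Real.exp (l * 0) := by positivity
      linarith
    · exact h
  refine ⟨ht0, ?_, fun h => ?_, fun h => ?_⟩
  · have h1 : HasDerivWithinAt (fun s => u s x - M * Real.exp (l * s))
        (ut t x - M * (Real.exp (l * t) * (l * 1))) (Ici 0) t :=
      hut.sub ((((hasDerivWithinAt_id t _).const_mul l).exp).const_mul M)
    have := nonneg_deriv_of_le_left ht0 Icc_subset_Ici_self h1 fun y hy => by
      have := hmax y ⟨hy.1, hy.2.trans ht.2⟩ x hx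
      linarith
    rw [hval]
    linarith
  · exact nonpos_deriv_of_le_right h (Icc_subset_Icc_left hx.1) hux fun y hy => by
      rw [hval]; exact hmax t ht y ⟨hx.1.trans hy.1, hy.2⟩
  · exact nonneg_deriv_of_le_left h (Icc_subset_Icc_right hx.2) hux fun y hy => by
      rw [hval]; exact hmax t ht y ⟨hy.1, hy.2.trans hx.2⟩

theorem IsSolCL.difference_lt (hc : 0 < c) (hμ : 0 < μ) (hρeq : 0 < ρeq)
    (hw : 0 < f ρeq) (hhid : ∀ s ∈ Icc (0:ℝ) (ρmax - ε), h s = s)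
    (heq : ρeq ≤ c / (c + f ρeq) * (ρmax - ε))
    (hsol₁ : IsSolCL c μ ρeq f h ρ₁ v₁ ρt₁ ρx₁ vt₁ vx₁)
    (hsol₂ : IsSolCL c μ ρeq f h ρ₂ v₂ ρt₂ ρx₂ vt₂ vx₂)
    (hpos₁ : ∀ t ∈ Ici (0:ℝ), ∀ x ∈ Icc (0:ℝ) 1, 0 < ρ₁ t x ∧ 0 < v₁ t x)
    (hpos₂ : ∀ t ∈ Ici (0:ℝ), ∀ x ∈ Icc (0:ℝ) 1, 0 < ρ₂ t x ∧ 0 < v₂ t x)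
    (hinit : ∀ x ∈ Icc (0:ℝ) 1, ρ₂ 0 x = ρ₁ 0 x ∧ v₂ 0 x = v₁ 0 x)
    {T l M R L C : ℝ} (hM : 0 < M) (hL : 0 ≤ L)
    (hR : ∀ t ∈ Icc 0 T, ρ₁ t 1 ≤ R)
    (hC : ∀ t ∈ Icc 0 T, ∀ x ∈ Icc (0:ℝ) 1,
      |ρx₁ t x * (c + v₁ t x) + ρ₁ t x * vx₁ t x| ≤ C)
    (hfL : ∀ t ∈ Icc 0 T, |f (ρ₂ t 1) - f (ρ₁ t 1)| ≤ L * |ρ₂ t 1 - ρ₁ t 1|)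
    (hl₁ : 0 < l) (hl₂ : C < l) (hl₃ : μ * L * (1 + R) / c ≤ l)
    (hd : ∀ s ∈ Icc 0 T, ∀ y ∈ Icc (0:ℝ) 1, |v₂ s y - v₁ s y| ≤ M * Real.exp (l * s))
    (he : ∀ s ∈ Icc 0 T, ∀ y ∈ Icc (0:ℝ) 1,
      |ρ₂ s y * (c + v₂ s y) - ρ₁ s y * (c + v₁ s y)| ≤ M * Real.exp (l * s)) :
    ∀ t ∈ Icc 0 T, ∀ x ∈ Icc (0:ℝ) 1, v₂ t x - v₁ t x < M * Real.exp (l * t) ∧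
      ρ₂ t x * (c + v₂ t x) - ρ₁ t x * (c + v₁ t x) < M * Real.exp (l * t) := by
  obtain ⟨-, -, -, -, -, -, hder₁, hpde₁, hbc₁⟩ := id hsol₁
  obtain ⟨-, -, -, -, -, -, hder₂, hpde₂, hbc₂⟩ := id hsol₂
  intro t ht x hx
  have hE : 0 < M * Real.exp (l * t) := mul_pos hM (Real.exp_pos _)
  obtain ⟨hp₁, hq₁⟩ := hpos₁ t ht.1 x hx
  obtain ⟨hp₂, hq₂⟩ := hpos₂ t ht.1 x hx
  obtain ⟨hir, hiv⟩ := hinit x hx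
  refine ⟨lt_of_le_of_ne ((le_abs_self _).trans (hd t ht x hx)) fun hval => ?_,
    lt_of_le_of_ne ((le_abs_self _).trans (he t ht x hx)) fun hval => ?_⟩
  · obtain ⟨ht0, h1, h2, -⟩ := weighted_max_conditions (u := fun t x => v₂ t x - v₁ t x)
      (ut := fun t x => vt₂ t x - vt₁ t x) (ux := fun t x => vx₂ t x - vx₁ t x) hM ht hx
      ((hder₂ t ht.1 x hx).2.2.1.sub (hder₁ t ht.1 x hx).2.2.1)
      ((hder₂ t ht.1 x hx).2.2.2.sub (hder₁ t ht.1 x hx).2.2.2)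
      (by rw [hiv, sub_self])
      (fun s hs y hy => (le_abs_self _).trans (hd s hs y hy)) hval
    have hlE : 0 < l * (v₂ t x - v₁ t x) := by rw [hval]; positivity
    rcases hx.2.eq_or_lt with h3 | h3
    · subst h3
      rw [(hbc₁ t ht.1).2, (hbc₂ t ht.1).2] at h1
      have h4 : |ρ₂ t 1 - ρ₁ t 1| ≤ (1 + R) / c * (M * Real.exp (l * t)) := by
        have e1 : ρ₂ t 1 - ρ₁ t 1 = (ρ₂ t 1 * (c + v₂ t 1) - ρ₁ t 1 * (c + v₁ t 1)
            - ρ₁ t 1 * (v₂ t 1 - v₁ t 1)) / (c + v₂ t 1) := by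
          rw [eq_div_iff (by positivity)]; ring
        rw [e1, abs_div, abs_of_pos (show 0 < c + v₂ t 1 by positivity), div_le_iff₀ (by positivity)]
        have e2 := he t ht 1 hx
        have e3 : |ρ₁ t 1 * (v₂ t 1 - v₁ t 1)| ≤ R * (M * Real.exp (l * t)) := by
          rw [abs_mul, abs_of_pos hp₁]
          exact mul_le_mul (hR t ht) (hd t ht 1 hx) (abs_nonneg _) (hp₁.le.trans (hR t ht))
        refine (abs_sub _ _).trans ((add_le_add e2 e3).trans ?_)
        have hR0 : 0 ≤ R := hp₁.le.trans (hR t ht)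
        have e4 : 0 ≤ (1 + R) / c * (M * Real.exp (l * t)) * v₂ t 1 := by positivity
        have e5 : (1 + R) / c * (M * Real.exp (l * t)) * c = (1 + R) * (M * Real.exp (l * t)) := by
          field_simp
        linarith
      have h5 := (le_abs_self _).trans ((hfL t ht).trans (mul_le_mul_of_nonneg_left h4 hL))
      have h6 : μ * (f (ρ₂ t 1) - f (ρ₁ t 1)) ≤ l * (M * Real.exp (l * t)) := by
        refine (mul_le_mul_of_nonneg_left h5 hμ.le).trans ?_
        calc μ * (L * ((1 + R) / c * (M * Real.exp (l * t))))
            = μ * L * (1 + R) / c * (M * Real.exp (l * t)) := by ring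
          _ ≤ _ := mul_le_mul_of_nonneg_right hl₃ hE.le
      rw [hval] at h1
      have h7 : 0 < μ * (v₂ t 1 - v₁ t 1) := by rw [hval]; positivity
      linarith
    · have h4 := (hpde₁ t ht.1 x hx).2
      have h5 := (hpde₂ t ht.1 x hx).2
      have h6 := mul_nonpos_of_nonneg_of_nonpos hc.le (h2 h3)
      linarith
  · obtain ⟨ht0, h1, -, h2⟩ := weighted_max_conditions
      (u := fun t x => ρ₂ t x * (c + v₂ t x) - ρ₁ t x * (c + v₁ t x))
      (ut := fun t x => (ρt₂ t x * (c + v₂ t x) + ρ₂ t x * vt₂ t x)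
        - (ρt₁ t x * (c + v₁ t x) + ρ₁ t x * vt₁ t x))
      (ux := fun t x => (ρx₂ t x * (c + v₂ t x) + ρ₂ t x * vx₂ t x)
        - (ρx₁ t x * (c + v₁ t x) + ρ₁ t x * vx₁ t x)) hM ht hx
      ((invariant_hasDeriv hsol₂ ht.1 hx).1.sub (invariant_hasDeriv hsol₁ ht.1 hx).1)
      ((invariant_hasDeriv hsol₂ ht.1 hx).2.sub (invariant_hasDeriv hsol₁ ht.1 hx).2)
      (by rw [hir, hiv, sub_self])
      (fun s hs y hy => (le_abs_self _).trans (he s hs y hy)) hval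
    rcases hx.1.eq_or_lt with h3 | h3
    · subst h3
      rw [(hbc₁ t ht.1).1, (hbc₂ t ht.1).1, feedback_flow_eq hc hw hρeq hhid heq hq₁,
        feedback_flow_eq hc hw hρeq hhid heq hq₂, div_mul_cancel₀ _ (by linarith),
        div_mul_cancel₀ _ (by linarith), sub_self] at hval
      linarith
    · have h4 := invariant_transport hsol₁ ht.1 hx
      have h5 := invariant_transport hsol₂ ht.1 hx
      have h6 := mul_nonneg hq₂.le (h2 h3)
      have h7 : |(v₂ t x - v₁ t x) * (ρx₁ t x * (c + v₁ t x) + ρ₁ t x * vx₁ t x)| ≤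
          M * Real.exp (l * t) * C := by
        rw [abs_mul]
        exact mul_le_mul (hd t ht x hx) (hC t ht x hx) (abs_nonneg _) hE.le
      have h8 := neg_le_of_abs_le h7
      rw [hval] at h1
      have h9 : M * Real.exp (l * t) * C < M * Real.exp (l * t) * l := mul_lt_mul_of_pos_left hl₂ hE
      linarith

theorem IsSolCL.unique (hc : 0 < c) (hμ : 0 < μ) (hρeq : 0 < ρeq)
    (hf1 : ContDiffOn ℝ 1 f (Ici 0)) (hw : 0 < f ρeq)
    (hhid : ∀ s ∈ Icc (0:ℝ) (ρmax - ε), h s = s)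
    (heq : ρeq ≤ c / (c + f ρeq) * (ρmax - ε))
    (hsol₁ : IsSolCL c μ ρeq f h ρ₁ v₁ ρt₁ ρx₁ vt₁ vx₁)
    (hsol₂ : IsSolCL c μ ρeq f h ρ₂ v₂ ρt₂ ρx₂ vt₂ vx₂)
    (hpos₁ : ∀ t ∈ Ici (0:ℝ), ∀ x ∈ Icc (0:ℝ) 1, 0 < ρ₁ t x ∧ 0 < v₁ t x)
    (hpos₂ : ∀ t ∈ Ici (0:ℝ), ∀ x ∈ Icc (0:ℝ) 1, 0 < ρ₂ t x ∧ 0 < v₂ t x)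
    (hinit : ∀ x ∈ Icc (0:ℝ) 1, ρ₂ 0 x = ρ₁ 0 x ∧ v₂ 0 x = v₁ 0 x) :
    ∀ t ∈ Ici (0:ℝ), ∀ x ∈ Icc (0:ℝ) 1, ρ₂ t x = ρ₁ t x ∧ v₂ t x = v₁ t x := by
  intro T hT X hX
  have hT0 : (0:ℝ) ≤ T := hT
  have hsub : Icc 0 T ×ˢ Icc (0:ℝ) 1 ⊆ Ici 0 ×ˢ Icc 0 1 :=
    prod_mono Icc_subset_Ici_self le_rfl
  have hcmp : IsCompact (Icc 0 T ×ˢ Icc (0:ℝ) 1) := isCompact_Icc.prod isCompact_Icc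
  obtain ⟨cρ₁, cv₁, -, cρx₁, -, cvx₁, -, -, -⟩ := id hsol₁
  obtain ⟨cρ₂, cv₂, -, cρx₂, -, cvx₂, -, -, -⟩ := id hsol₂
  have hbound : ∀ {u : ℝ → ℝ → ℝ}, ContinuousOn (fun q : ℝ × ℝ => u q.1 q.2) (Ici 0 ×ˢ Icc 0 1) →
      ∃ B, ∀ t ∈ Icc 0 T, ∀ x ∈ Icc (0:ℝ) 1, |u t x| ≤ B := by
    intro u hu
    obtain ⟨B, hB⟩ := hcmp.exists_bound_of_continuousOn (hu.mono hsub)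
    exact ⟨B, fun t ht x hx => hB (t, x) ⟨ht, hx⟩⟩
  obtain ⟨R₁, hR₁⟩ := hbound cρ₁
  obtain ⟨R₂, hR₂⟩ := hbound cρ₂
  obtain ⟨C₁, hC₁⟩ := hbound (u := fun t x => ρx₁ t x * (c + v₁ t x) + ρ₁ t x * vx₁ t x)
    ((cρx₁.mul (continuousOn_const.add cv₁)).add (cρ₁.mul cvx₁))
  obtain ⟨C₂, hC₂⟩ := hbound (u := fun t x => ρx₂ t x * (c + v₂ t x) + ρ₂ t x * vx₂ t x)
    ((cρx₂.mul (continuousOn_const.add cv₂)).add (cρ₂.mul cvx₂))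
  set R := max R₁ R₂
  set C := max C₁ C₂
  obtain ⟨L, hL⟩ := ((hf1.mono Icc_subset_Ici_self).locallyLipschitzOn
    (convex_Icc 0 R)).exists_lipschitzOnWith_of_compact isCompact_Icc
  have h1mem : (1:ℝ) ∈ Icc (0:ℝ) 1 := by simp
  have hr₁ : ∀ t ∈ Icc 0 T, ρ₁ t 1 ∈ Icc 0 R := fun t ht =>
    ⟨(hpos₁ t ht.1 1 h1mem).1.le, (le_abs_self _).trans ((hR₁ t ht 1 h1mem).trans (le_max_left _ _))⟩
  have hr₂ : ∀ t ∈ Icc 0 T, ρ₂ t 1 ∈ Icc 0 R := fun t ht =>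
    ⟨(hpos₂ t ht.1 1 h1mem).1.le, (le_abs_self _).trans ((hR₂ t ht 1 h1mem).trans (le_max_right _ _))⟩
  have hfL : ∀ a ∈ Icc 0 R, ∀ b ∈ Icc 0 R, |f a - f b| ≤ L * |a - b| := fun a ha b hb =>
    hL.dist_le_mul a ha b hb
  set l := max 1 (max (C + 1) (μ * L * (1 + R) / c))
  have hl₁ : 0 < l := zero_lt_one.trans_le (le_max_left _ _)
  have hl₂ : C < l := (lt_add_one C).trans_le ((le_max_left _ _).trans (le_max_right _ _))
  have hl₃ : μ * L * (1 + R) / c ≤ l := (le_max_right _ _).trans (le_max_right _ _)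
  set W : ℝ × ℝ → ℝ := fun q => max |v₂ q.1 q.2 - v₁ q.1 q.2|
    |ρ₂ q.1 q.2 * (c + v₂ q.1 q.2) - ρ₁ q.1 q.2 * (c + v₁ q.1 q.2)| * Real.exp (-(l * q.1)) with hW
  have hWc : ContinuousOn W (Icc 0 T ×ˢ Icc 0 1) := by
    refine ContinuousOn.mul (continuous_max.comp_continuousOn (ContinuousOn.prodMk ?_ ?_))
      (by fun_prop)
    · exact ((cv₂.sub cv₁).mono hsub).abs
    · exact (((cρ₂.mul (continuousOn_const.add cv₂)).sub
        (cρ₁.mul (continuousOn_const.add cv₁))).mono hsub).abs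
  obtain ⟨⟨t, x⟩, ⟨ht, hx⟩, hmax⟩ := hcmp.exists_isMaxOn ⟨(T, X), ⟨hT0, le_rfl⟩, hX⟩ hWc
  have hmax' : ∀ s ∈ Icc 0 T, ∀ y ∈ Icc (0:ℝ) 1, W (s, y) ≤ W (t, x) := fun s hs y hy =>
    hmax (show (s, y) ∈ Icc 0 T ×ˢ Icc (0:ℝ) 1 from ⟨hs, hy⟩)
  dsimp only at ht hx
  set M := W (t, x) with hMdef
  have hle : ∀ s ∈ Icc 0 T, ∀ y ∈ Icc (0:ℝ) 1, max |v₂ s y - v₁ s y|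
      |ρ₂ s y * (c + v₂ s y) - ρ₁ s y * (c + v₁ s y)| ≤ M * Real.exp (l * s) := by
    intro s hs y hy
    have := hmax' s hs y hy
    simp only [hW, Real.exp_neg] at this
    rwa [← div_eq_mul_inv, div_le_iff₀ (Real.exp_pos _)] at this
  have hM : M ≤ 0 := by
    by_contra! hM
    have hval : max |v₂ t x - v₁ t x| |ρ₂ t x * (c + v₂ t x) - ρ₁ t x * (c + v₁ t x)|
        = M * Real.exp (l * t) := by
      rw [hMdef]
      simp only [hW, mul_assoc]
      rw [← Real.exp_add, neg_add_cancel, Real.exp_zero, mul_one]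
    have hd := fun s hs y hy => (le_max_left _ _).trans (hle s hs y hy)
    have he := fun s hs y hy => (le_max_right _ _).trans (hle s hs y hy)
    have k₁ := IsSolCL.difference_lt hc hμ hρeq hw hhid heq hsol₁ hsol₂ hpos₁ hpos₂ hinit hM
      L.coe_nonneg (fun t ht => (hr₁ t ht).2)
      (fun t ht x hx => (hC₁ t ht x hx).trans (le_max_left _ _))
      (fun t ht => hfL _ (hr₂ t ht) _ (hr₁ t ht)) hl₁ hl₂ hl₃ hd he t ht x hx
    have k₂ := IsSolCL.difference_lt hc hμ hρeq hw hhid heq hsol₂ hsol₁ hpos₂ hpos₁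
      (fun x hx => ⟨(hinit x hx).1.symm, (hinit x hx).2.symm⟩) hM
      L.coe_nonneg (fun t ht => (hr₂ t ht).2)
      (fun t ht x hx => (hC₂ t ht x hx).trans (le_max_right _ _))
      (fun t ht => hfL _ (hr₁ t ht) _ (hr₂ t ht)) hl₁ hl₂ hl₃
      (fun s hs y hy => by rw [abs_sub_comm]; exact hd s hs y hy)
      (fun s hs y hy => by rw [abs_sub_comm]; exact he s hs y hy) t ht x hx
    refine absurd hval (ne_of_lt (max_lt (abs_lt.2 ⟨?_, k₁.1⟩) (abs_lt.2 ⟨?_, k₁.2⟩)))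
    · linarith [k₂.1]
    · linarith [k₂.2]
  have hz := (hle T ⟨hT0, le_rfl⟩ X hX).trans
    (mul_nonpos_of_nonpos_of_nonneg hM (Real.exp_pos _).le)
  have hv : v₂ T X = v₁ T X :=
    sub_eq_zero.1 (abs_nonpos_iff.1 ((le_max_left _ _).trans hz))
  have hzz := sub_eq_zero.1 (abs_nonpos_iff.1 ((le_max_right _ _).trans hz))
  rw [hv] at hzz
  have := (hpos₁ T hT X hX).2
  exact ⟨mul_right_cancel₀ (by positivity) hzz, hv⟩

end Uniqueness

theorem le_of_barrier {y y' B B' : ℝ → ℝ} {t₀ : ℝ} (hy : ∀ t ≥ t₀, HasDerivAt y (y' t) t)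
    (hB : ∀ t ≥ t₀, HasDerivAt B (B' t) t) (h0 : y t₀ ≤ B t₀)
    (hs : ∀ t ≥ t₀, B t < y t → y' t ≤ B' t) : ∀ t ≥ t₀, y t ≤ B t := by
  intro t₁ ht₁
  by_contra! hlt
  obtain ⟨δ, hδ, hδt⟩ : ∃ δ > 0, 0 < y t₁ - B t₁ - δ * (t₁ - t₀) := by
    refine ⟨(y t₁ - B t₁) / (2 * (t₁ - t₀ + 1)), div_pos (by linarith) (by linarith), ?_⟩
    have : (y t₁ - B t₁) / (2 * (t₁ - t₀ + 1)) * (t₁ - t₀) < y t₁ - B t₁ := by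
      rw [div_mul_eq_mul_div, div_lt_iff₀ (by linarith)]
      nlinarith
    linarith
  have hder : ∀ t ≥ t₀, HasDerivAt (fun t => y t - B t - δ * (t - t₀)) (y' t - B' t - δ) t := by
    intro t ht
    have := ((hy t ht).sub (hB t ht)).sub (((hasDerivAt_id t).sub_const t₀).const_mul δ)
    rw [mul_one] at this
    exact this
  obtain ⟨t, ht, hmax⟩ := isCompact_Icc.exists_isMaxOn (nonempty_Icc.2 ht₁)
    (fun t ht => (hder t ht.1).continuousAt.continuousWithinAt)
  have hval : 0 < y t - B t - δ * (t - t₀) := hδt.trans_le (hmax (right_mem_Icc.2 ht₁))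
  have ht0 : t₀ < t := by
    rcases ht.1.eq_or_lt with h | h
    · subst h
      linarith
    · exact h
  have h1 := nonneg_deriv_of_le_left ht0 subset_rfl (hder t ht.1).hasDerivWithinAt
    fun s hs => hmax ⟨hs.1, hs.2.trans ht.2⟩
  have h2 : 0 ≤ δ * (t - t₀) := mul_nonneg hδ.le (by linarith)
  have := hs t ht.1 (by linarith)
  linarith

theorem abs_sub_le_of_abs_log_le {a b m : ℝ} (ha : 0 < a) (hb : 0 < b)
    (h : |Real.log (a / b)| ≤ m) :
    b * Real.exp (-m) ≤ a ∧ a ≤ b * Real.exp m ∧ |a - b| ≤ b * (Real.exp m - 1) := by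
  obtain ⟨h1, h2⟩ := abs_le.1 h
  have hab : 0 < a / b := div_pos ha hb
  rw [Real.log_le_iff_le_exp hab, div_le_iff₀ hb] at h2
  rw [Real.le_log_iff_exp_le hab, le_div_iff₀ hb] at h1
  have h3 : 2 ≤ Real.exp m + Real.exp (-m) := by
    have := Real.add_one_le_exp m
    have := Real.add_one_le_exp (-m)
    linarith
  refine ⟨by linarith, by linarith, abs_le.2 ⟨by nlinarith, by linarith⟩⟩

theorem abs_log_div_le {a b d : ℝ} (hd : 0 < d) (ha : d ≤ a) (hb : d ≤ b) :
    |Real.log (a / b)| ≤ |a - b| / d := by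
  have ha' := hd.trans_le ha
  have hb' := hd.trans_le hb
  have key : ∀ x y : ℝ, 0 < x → d ≤ y → Real.log (x / y) ≤ |x - y| / d := by
    intro x y hx hy
    have hy' := hd.trans_le hy
    calc Real.log (x / y) ≤ x / y - 1 := Real.log_le_sub_one_of_pos (div_pos hx hy')
      _ = (x - y) / y := by field_simp
      _ ≤ |x - y| / y := div_le_div_of_nonneg_right (le_abs_self _) hy'.le
      _ ≤ |x - y| / d := div_le_div_of_nonneg_left (abs_nonneg _) hd hy
  refine abs_le.2 ⟨?_, key a b ha' hb⟩
  have := key b a hb' ha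
  rw [← inv_div, Real.log_inv, abs_sub_comm] at this
  linarith

/-- The data recorded at the outlet by a closed-loop trajectory: the outlet velocity `V`, the
label `E` of the characteristic reaching the outlet (nonnegative once the characteristic comes
from the inlet) and the transported invariant `z`. -/
structure OutletTrajectory (c μ ρeq : ℝ) (f : ℝ → ℝ) (m : ℝ) (V E z : ℝ → ℝ) : Prop where
  hasDerivAt_velocity : ∀ t ≥ 0, HasDerivAt V (-μ * (V t - f (z t / (c + V t)))) t
  hasDerivAt_label : ∀ t ≥ 0, HasDerivAt E (V t / (c + V t)) t
  velocity_pos : ∀ t ≥ 0, 0 < V t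
  velocity_zero : |Real.log (V 0 / f ρeq)| ≤ m
  label_zero : -(1 / c) ≤ E 0
  invariant_pos : ∀ t ≥ 0, 0 < z t
  invariant_le : ∀ t ≥ 0, |Real.log (z t / (ρeq * (c + f ρeq)))| ≤ m
  invariant_eq : ∀ t ≥ 0, 0 ≤ E t → z t = ρeq * (c + f ρeq)

section Stability

variable {c μ ρeq : ℝ} {f : ℝ → ℝ}

theorem OutletTrajectory.bounds (hc : 0 < c) (hμ : 0 < μ) (hρeq : 0 < ρeq)
    (hf1 : ContDiffOn ℝ 1 f (Ici 0)) (hfpos : ∀ x ∈ Ici (0:ℝ), 0 < f x)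
    (hfanti : AntitoneOn f (Ici 0))
    (hsign : ∀ v : ℝ, 0 ≤ v → v ≠ f ρeq →
      0 < (v - f (ρeq * (c + f ρeq) / (c + v))) * (v - f ρeq)) (R : ℝ) :
    ∃ b > 0, ∃ C ≥ 0, ∃ T ≥ 0, b ≤ f ρeq ∧ ∀ m ≤ R, ∀ V E z : ℝ → ℝ,
      OutletTrajectory c μ ρeq f m V E z → (∀ t ≥ T, 0 ≤ E t) ∧
        ∀ t ≥ 0, b ≤ V t ∧ |V t - f ρeq| ≤ C * (Real.exp m - 1) := by
  have hw : 0 < f ρeq := hfpos _ hρeq.le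
  set w := f ρeq with hwdef
  set K := ρeq * (c + w) with hKdef
  have hK : 0 < K := by positivity
  set r := K * Real.exp R / c with hr
  have hr0 : 0 < r := by positivity
  obtain ⟨L, hL⟩ := ((hf1.mono Icc_subset_Ici_self).locallyLipschitzOn
    (convex_Icc 0 r)).exists_lipschitzOnWith_of_compact isCompact_Icc
  set b := min w (min (w * Real.exp (-R)) (f r)) with hbdef
  have hfr : 0 < f r := hfpos r hr0.le
  have hb : 0 < b := lt_min hw (lt_min (by positivity) hfr)
  set T := (c + b) / (c * b) with hT
  have hT0 : 0 ≤ T := by positivity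
  set C := w + μ * L * (K / c) * T with hC
  have hL0 : (0:ℝ) ≤ L := L.coe_nonneg
  refine ⟨b, hb, C, by positivity, T, hT0, min_le_left _ _, ?_⟩
  intro m hm V E z htr
  have hm0 : 0 ≤ m := (abs_nonneg _).trans htr.velocity_zero
  have hexp1 : 0 ≤ Real.exp m - 1 := by linarith [Real.add_one_le_exp m]
  have hzr : ∀ t ≥ 0, z t ≤ K * Real.exp R := fun t ht =>
    (abs_sub_le_of_abs_log_le (htr.invariant_pos t ht) hK (htr.invariant_le t ht)).2.1.trans
      (mul_le_mul_of_nonneg_left (Real.exp_le_exp.2 hm) hK.le)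
  have hmem : ∀ t ≥ 0, ∀ Z, 0 < Z → Z ≤ K * Real.exp R → Z / (c + V t) ∈ Icc 0 r := by
    intro t ht Z hZ hZr
    have := htr.velocity_pos t ht
    exact ⟨by positivity, div_le_div₀ (by positivity) hZr hc (by linarith)⟩
  have hV0 := abs_sub_le_of_abs_log_le (htr.velocity_pos 0 le_rfl) hw htr.velocity_zero
  have hlow : ∀ t ≥ 0, b ≤ V t := by
    have := le_of_barrier (y := fun t => -V t) (B := fun _ => -b) (t₀ := 0)
      (fun t ht => (htr.hasDerivAt_velocity t ht).neg) (fun t _ => hasDerivAt_const t (-b)) ?_ ?_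
    · intro t ht
      linarith [this t ht]
    · have h1 : w * Real.exp (-R) ≤ w * Real.exp (-m) :=
        mul_le_mul_of_nonneg_left (Real.exp_le_exp.2 (by linarith)) hw.le
      have h2 : b ≤ w * Real.exp (-R) := (min_le_right _ _).trans (min_le_left _ _)
      linarith [hV0.1]
    · intro t ht hlt
      have h1 := hmem t ht (z t) (htr.invariant_pos t ht) (hzr t ht)
      have h2 : f r ≤ f (z t / (c + V t)) := hfanti h1.1 hr0.le h1.2
      have h3 : b ≤ f r := (min_le_right _ _).trans (min_le_right _ _)
      nlinarith
  have hElab : ∀ t ≥ T, 0 ≤ E t := by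
    have := le_of_barrier (y := fun t => -E t) (B := fun t => 1 / c - b / (c + b) * t) (t₀ := 0)
      (B' := fun _ => -(b / (c + b) * 1))
      (fun t ht => (htr.hasDerivAt_label t ht).neg)
      (fun t _ => ((hasDerivAt_id t).const_mul (b / (c + b))).const_sub (1 / c)) ?_ ?_
    · intro t ht
      have h1 := this t (hT0.trans ht)
      have h2 : b / (c + b) * T ≤ b / (c + b) * t := mul_le_mul_of_nonneg_left ht (by positivity)
      have h3 : b / (c + b) * T = 1 / c := by
        rw [hT]; field_simp
      linarith
    · have := htr.label_zero
      simp only [mul_zero, sub_zero]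
      linarith
    · intro t ht _
      have h1 := hlow t ht
      have h2 : b / (c + b) ≤ V t / (c + V t) := by
        rw [div_le_div_iff₀ (by linarith) (by linarith)]
        nlinarith
      linarith
  have hpert : ∀ t ≥ 0, |f (z t / (c + V t)) - f (K / (c + V t))| ≤
      L * (K / c) * (Real.exp m - 1) := by
    intro t ht
    have h1 := hmem t ht (z t) (htr.invariant_pos t ht) (hzr t ht)
    have h2 := hmem t ht K hK (le_mul_of_one_le_right hK.le (Real.one_le_exp (hm0.trans hm)))
    have h3 := hL.dist_le_mul _ h1 _ h2
    rw [Real.dist_eq, Real.dist_eq, ← sub_div, abs_div] at h3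
    have hv := htr.velocity_pos t ht
    rw [abs_of_pos (show 0 < c + V t by linarith)] at h3
    have h4 := (abs_sub_le_of_abs_log_le (htr.invariant_pos t ht) hK (htr.invariant_le t ht)).2.2
    calc _ ≤ _ := h3
      _ ≤ L * (K * (Real.exp m - 1) / c) := by
        refine mul_le_mul_of_nonneg_left (div_le_div₀ (by positivity) h4 hc (by linarith)) hL0
      _ = _ := by ring
  have hup_sign : ∀ v, w < v → 0 < v - f (K / (c + v)) := fun v hv =>
    pos_of_mul_pos_left (hsign v (hw.le.trans hv.le) hv.ne') (by linarith)
  have hlow_sign : ∀ v, 0 ≤ v → v < w → v - f (K / (c + v)) < 0 := fun v hv0 hv =>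
    neg_of_mul_pos_left (hsign v hv0 hv.ne) (by linarith)
  set κ := μ * (L * (K / c) * (Real.exp m - 1)) with hκ
  have hκ0 : 0 ≤ κ := by positivity
  have hphase : ∀ t₀ ≥ 0, ∀ A ≥ 0, ∀ k ≥ 0, |V t₀ - w| ≤ A →
      (∀ t ≥ t₀, μ * |f (z t / (c + V t)) - f (K / (c + V t))| ≤ k) →
      ∀ t ≥ t₀, |V t - w| ≤ A + k * (t - t₀) := by
    intro t₀ ht₀ A hA k hk hA0 hkf t ht
    obtain ⟨a1, a2⟩ := abs_le.1 hA0
    have hB : ∀ t ≥ t₀, HasDerivAt (fun t => A + k * (t - t₀)) (k * 1) t := fun t _ =>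
      (((hasDerivAt_id t).sub_const t₀).const_mul k).const_add A
    have hnn : ∀ t ≥ t₀, 0 ≤ A + k * (t - t₀) := fun t ht =>
      add_nonneg hA (mul_nonneg hk (by linarith))
    refine abs_le.2 ⟨?_, ?_⟩
    · have := le_of_barrier (y := fun t => w - V t) (t₀ := t₀)
        (fun t ht => (htr.hasDerivAt_velocity t (ht₀.trans ht)).const_sub w) hB
        (by simp only [sub_self, mul_zero]; linarith) (fun s hs hlt => ?_) t ht
      · linarith
      · have h1 := hlow_sign (V s) (htr.velocity_pos s (ht₀.trans hs)).le (by
          have := hnn s hs; linarith)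
        have h2 := hkf s hs
        have h3 := mul_le_mul_of_nonneg_left
          (neg_abs_le (f (z s / (c + V s)) - f (K / (c + V s)))) hμ.le
        have h4 := mul_pos hμ (neg_pos.2 h1)
        linarith
    · have := le_of_barrier (y := fun t => V t - w) (t₀ := t₀)
        (fun t ht => (htr.hasDerivAt_velocity t (ht₀.trans ht)).sub_const w) hB
        (by simp only [sub_self, mul_zero]; linarith) (fun s hs hlt => ?_) t ht
      · linarith
      · have h1 := hup_sign (V s) (by have := hnn s hs; linarith)
        have h2 := hkf s hs
        have h3 := mul_le_mul_of_nonneg_left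
          (le_abs_self (f (z s / (c + V s)) - f (K / (c + V s)))) hμ.le
        have h4 := mul_pos hμ h1
        linarith
  have hearly : ∀ t ≥ 0, |V t - w| ≤ w * (Real.exp m - 1) + κ * (t - 0) :=
    hphase 0 le_rfl _ (by positivity) κ hκ0 hV0.2.2
      fun t ht => mul_le_mul_of_nonneg_left (hpert t ht) hμ.le
  have hCeq : w * (Real.exp m - 1) + κ * T = C * (Real.exp m - 1) := by
    rw [hκ, hC]; ring
  refine ⟨hElab, fun t ht => ⟨hlow t ht, ?_⟩⟩
  rcases le_total t T with h1 | h1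
  · have := hearly t ht
    have := mul_le_mul_of_nonneg_left h1 hκ0
    linarith
  · have h2 := hphase T hT0 (C * (Real.exp m - 1)) (by positivity) 0 le_rfl ?_ ?_ t h1
    · linarith
    · have := hearly T hT0
      linarith
    · intro s hs
      rw [htr.invariant_eq s (hT0.trans hs) (hElab s hs)]
      simp [hKdef, hwdef]

theorem OutletTrajectory.log_bound (hc : 0 < c) (hμ : 0 < μ) (hρeq : 0 < ρeq)
    (hf1 : ContDiffOn ℝ 1 f (Ici 0)) (hfpos : ∀ x ∈ Ici (0:ℝ), 0 < f x)
    (hfanti : AntitoneOn f (Ici 0))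
    (hsign : ∀ v : ℝ, 0 ≤ v → v ≠ f ρeq →
      0 < (v - f (ρeq * (c + f ρeq) / (c + v))) * (v - f ρeq)) (R : ℝ) :
    ∃ C ≥ 0, ∀ m ≤ R, ∀ V E z : ℝ → ℝ, OutletTrajectory c μ ρeq f m V E z →
      ∀ t ≥ 0, |Real.log (V t / f ρeq)| ≤ C * (Real.exp m - 1) := by
  obtain ⟨b, hb, C, hC, T, -, hbw, H⟩ :=
    OutletTrajectory.bounds hc hμ hρeq hf1 hfpos hfanti hsign R
  refine ⟨C / b, by positivity, fun m hm V E z htr t ht => ?_⟩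
  obtain ⟨h1, h2⟩ := (H m hm V E z htr).2 t ht
  refine (abs_log_div_le hb h1 hbw).trans ?_
  rw [div_mul_eq_mul_div]
  exact div_le_div_of_nonneg_right h2 hb.le

theorem OutletTrajectory.attraction (hc : 0 < c) (hμ : 0 < μ) (hρeq : 0 < ρeq)
    (hf1 : ContDiffOn ℝ 1 f (Ici 0)) (hfpos : ∀ x ∈ Ici (0:ℝ), 0 < f x)
    (hfanti : AntitoneOn f (Ici 0))
    (hsign : ∀ v : ℝ, 0 ≤ v → v ≠ f ρeq →
      0 < (v - f (ρeq * (c + f ρeq) / (c + v))) * (v - f ρeq)) (R : ℝ) {e : ℝ} (he : 0 < e) :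
    ∃ T ≥ 0, ∀ m ≤ R, ∀ V E z : ℝ → ℝ, OutletTrajectory c μ ρeq f m V E z →
      ∀ t ≥ T, 0 ≤ E t ∧ |Real.log (V t / f ρeq)| ≤ e := by
  obtain ⟨b, hb, C, hC, T, hT, hbw, H⟩ :=
    OutletTrajectory.bounds hc hμ hρeq hf1 hfpos hfanti hsign (max R 0)
  have hw : 0 < f ρeq := hfpos _ hρeq.le
  set w := f ρeq with hwdef
  set K := ρeq * (c + w) with hKdef
  have hK : 0 < K := by positivity
  set A := w + C * (Real.exp (max R 0) - 1) with hA
  have hAw : w ≤ A := by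
    have : 1 ≤ Real.exp (max R 0) := Real.one_le_exp (le_max_right _ _)
    have : 0 ≤ C * (Real.exp (max R 0) - 1) := mul_nonneg hC (by linarith)
    linarith
  have hA0 : 0 < A := hw.trans_le hAw
  set η := b * e / 2 with hη
  have hη0 : 0 < η := by positivity
  obtain ⟨p, hp, hpF⟩ : ∃ p > 0, ∀ v ∈ Icc 0 A, η ≤ |v - w| → p ≤ |v - f (K / (c + v))| := by
    have hcmp : IsCompact (Icc 0 A ∩ {v | η ≤ |v - w|}) :=
      isCompact_Icc.inter_right (isClosed_le continuous_const (by fun_prop))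
    have hcont : ContinuousOn (fun v => |v - f (K / (c + v))|) (Icc 0 A ∩ {v | η ≤ |v - w|}) := by
      refine (continuousOn_id.sub (hf1.continuousOn.comp (continuousOn_const.div (by fun_prop)
        fun v hv => ?_) fun v hv => ?_)).abs
      · have := hv.1.1
        positivity
      · have := hv.1.1
        exact mem_Ici.2 (div_nonneg hK.le (add_nonneg hc.le this))
    rcases (Icc 0 A ∩ {v | η ≤ |v - w|}).eq_empty_or_nonempty with h1 | h1
    · refine ⟨1, one_pos, fun v hv hv' => ?_⟩
      have : v ∈ Icc 0 A ∩ {v | η ≤ |v - w|} := ⟨hv, hv'⟩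
      rw [h1] at this
      exact this.elim
    · obtain ⟨v₁, hv₁, hmin⟩ := hcmp.exists_isMinOn h1 hcont
      refine ⟨|v₁ - f (K / (c + v₁))|, ?_, fun v hv hv' => hmin ⟨hv, hv'⟩⟩
      have hne : v₁ ≠ w := by
        rintro rfl
        have h2 : η ≤ |w - w| := hv₁.2
        simp only [sub_self, abs_zero] at h2
        linarith
      exact abs_pos.2 (left_ne_zero_of_mul (hsign v₁ hv₁.1.1 hne).ne')
  set k := μ * p / A with hk
  have hk0 : 0 < k := by positivity
  obtain ⟨T₂, hT₂⟩ : ∃ T₂, ∀ s ≥ T₂, A * Real.exp (-(k * s)) ≤ η := by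
    have h1 : Tendsto (fun s : ℝ => A * Real.exp (-(k * s))) atTop (nhds (A * 0)) :=
      ((Real.tendsto_exp_neg_atTop_nhds_zero).comp
        (tendsto_id.const_mul_atTop hk0)).const_mul A
    rw [mul_zero] at h1
    exact eventually_atTop.1 (h1.eventually_le_const hη0)
  refine ⟨T + max T₂ 0, by positivity, fun m hm V E z htr t ht => ?_⟩
  obtain ⟨hE, hV⟩ := H m (hm.trans (le_max_left _ _)) V E z htr
  have htT : T ≤ t := by linarith [le_max_right T₂ 0]
  refine ⟨hE t htT, ?_⟩
  have hVA : ∀ s ≥ T, |V s - w| ≤ A - w := fun s hs => by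
    refine ((hV s (hT.trans hs)).2).trans ?_
    rw [hA, add_sub_cancel_left]
    exact mul_le_mul_of_nonneg_left (sub_le_sub_right
      (Real.exp_le_exp.2 (hm.trans (le_max_left _ _))) _) hC
  have hder : ∀ s ≥ T, HasDerivAt V (-μ * (V s - f (K / (c + V s)))) s := by
    intro s hs
    have := htr.hasDerivAt_velocity s (hT.trans hs)
    rwa [htr.invariant_eq s (hT.trans hs) (hE s hs)] at this
  have hBder : ∀ s ≥ T, HasDerivAt (fun s => η + A * Real.exp (-(k * (s - T))))
      (A * (Real.exp (-(k * (s - T))) * -(k * 1))) s := fun s _ =>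
    (((((hasDerivAt_id s).sub_const T).const_mul k).neg.exp).const_mul A).const_add η
  have hBpos : ∀ s, 0 < A * Real.exp (-(k * (s - T))) := fun s => mul_pos hA0 (Real.exp_pos _)
  have hBle : ∀ s ≥ T, -(μ * p) ≤ A * (Real.exp (-(k * (s - T))) * -(k * 1)) := by
    intro s hs
    have h1 : Real.exp (-(k * (s - T))) ≤ 1 :=
      Real.exp_le_one_iff.2 (by nlinarith)
    have h2 : A * k = μ * p := by rw [hk]; field_simp
    have h3 : 0 < μ * p := by positivity
    calc -(μ * p) ≤ -(μ * p * Real.exp (-(k * (s - T)))) := by nlinarith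
      _ = _ := by rw [← h2]; ring
  have hB0 : η + A * Real.exp (-(k * (T - T))) = η + A := by simp
  have hsmall : |V t - w| ≤ b * e := by
    have h5 := hT₂ (t - T) (by linarith [le_max_left T₂ 0])
    refine abs_le.2 ⟨?_, ?_⟩
    · have := le_of_barrier (y := fun s => w - V s) (t₀ := T)
        (fun s hs => (hder s hs).const_sub w) hBder
        (by rw [hB0]; linarith [(hV T hT).1]) (fun s hs hlt => ?_) t htT
      · linarith
      · have h1 := hBpos s
        have h2 := (hV s (hT.trans hs)).1
        have h3 : V s < w := by linarith
        have h4 := hpF (V s) ⟨by linarith, by linarith⟩ (by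
          rw [abs_sub_comm]; exact (by linarith : η ≤ w - V s).trans (le_abs_self _))
        have h6 := neg_of_mul_pos_left (hsign (V s) (by linarith) h3.ne) (by linarith)
        rw [abs_of_neg h6] at h4
        have := mul_le_mul_of_nonneg_left h4 hμ.le
        have := hBle s hs
        linarith
    · have := le_of_barrier (y := fun s => V s - w) (t₀ := T)
        (fun s hs => (hder s hs).sub_const w) hBder
        (by rw [hB0]; linarith [le_of_abs_le (hVA T le_rfl)]) (fun s hs hlt => ?_) t htT
      · linarith
      · have h1 := hBpos s
        have h2 := (hV s (hT.trans hs)).1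
        have h3 : w < V s := by linarith
        have h4 := hpF (V s) ⟨by linarith, by linarith [le_of_abs_le (hVA s hs)]⟩
          ((by linarith : η ≤ V s - w).trans (le_abs_self _))
        have h6 := pos_of_mul_pos_left (hsign (V s) (by linarith) h3.ne') (by linarith)
        rw [abs_of_pos h6] at h4
        have := mul_le_mul_of_nonneg_left h4 hμ.le
        have := hBle s hs
        linarith
  refine (abs_log_div_le hb (hV t (hT.trans htT)).1 hbw).trans ?_
  rw [div_le_iff₀ hb]
  linarith

end Stability

theorem exists_hasDerivAt_of_lipschitzWith_of_bounded {E : Type*} [NormedAddCommGroup E]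
    [NormedSpace ℝ E] [CompleteSpace E] {F : E → E} {K L : NNReal} (hF : LipschitzWith K F)
    (hL : ∀ x, ‖F x‖ ≤ L) (x₀ : E) :
    ∃ γ : ℝ → E, γ 0 = x₀ ∧ ∀ t, HasDerivAt γ (F (γ t)) t := by
  have local_sol : ∀ n : ℕ, ∃ α : ℝ → E, α 0 = x₀ ∧
      ∀ t ∈ Ioo (-(n:ℝ) - 1) (n + 1), HasDerivAt α (F (α t)) t := by
    intro n
    have hn : (0:ℝ) ∈ Icc (-(n:ℝ) - 1) (n + 1) := by
      have : (0:ℝ) ≤ n := n.cast_nonneg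
      constructor <;> linarith
    have hpl : IsPicardLindelof (fun _ : ℝ => F) (tmin := -(n:ℝ) - 1) (tmax := n + 1)
        ⟨0, hn⟩ x₀ (L * (n + 1)) 0 L K := by
      refine IsPicardLindelof.of_time_independent (fun x _ => hL x) hF.lipschitzOnWith ?_
      push_cast
      rw [sub_zero, sub_zero, max_eq_left (by linarith)]
    obtain ⟨α, h0, hα⟩ := hpl.exists_eq_forall_mem_Icc_hasDerivWithinAt₀
    exact ⟨α, h0, fun t ht => (hα t (Ioo_subset_Icc_self ht)).hasDerivAt (Icc_mem_nhds ht.1 ht.2)⟩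
  choose α h0 hα using local_sol
  have hagree : ∀ m n : ℕ, m ≤ n → EqOn (α m) (α n) (Ioo (-(m:ℝ) - 1) (m + 1)) := by
    intro m n hmn
    have hmn' : (m:ℝ) ≤ n := by exact_mod_cast hmn
    have hm : (0:ℝ) ≤ m := m.cast_nonneg
    refine ODE_solution_unique_of_mem_Ioo (v := fun _ => F) (s := fun _ => univ) (K := K)
      (t₀ := 0) (fun _ _ => hF.lipschitzOnWith) ⟨by linarith, by linarith⟩
      (fun t ht => ⟨hα m t ht, mem_univ _⟩)
      (fun t ht => ⟨hα n t ⟨by linarith [ht.1], by linarith [ht.2]⟩, mem_univ _⟩)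
      (by rw [h0, h0])
  refine ⟨fun t => α ⌈|t|⌉₊ t, by simp [h0], fun t => ?_⟩
  have hmem : ∀ s : ℝ, ∀ n : ℕ, |s| < n + 1 → α ⌈|s|⌉₊ s = α n s := by
    intro s n hs
    have hs' : |s| ≤ ⌈|s|⌉₊ := Nat.le_ceil _
    obtain ⟨h1, h2⟩ := abs_le.1 hs'
    obtain ⟨h3, h4⟩ := abs_lt.1 hs
    rcases le_total ⌈|s|⌉₊ n with h | h
    · exact hagree _ _ h ⟨by linarith, by linarith⟩
    · exact (hagree _ _ h ⟨by linarith, by linarith⟩).symm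
  have ht : |t| < (⌈|t|⌉₊ : ℝ) + 1 := (Nat.le_ceil _).trans_lt (lt_add_one _)
  have hev : (fun s => α ⌈|s|⌉₊ s) =ᶠ[nhds t] α ⌈|t|⌉₊ := by
    filter_upwards [(continuous_abs.tendsto t).eventually (gt_mem_nhds ht)] with s hs
    exact hmem s _ hs
  obtain ⟨h3, h4⟩ := abs_lt.1 ht
  exact (hα _ t ⟨by linarith, by linarith⟩).congr_of_eventuallyEq hev

theorem eqOn_Icc_of_hasDerivWithinAt {g₁ g₂ g' : ℝ → ℝ} {a b : ℝ}
    (h₁ : ∀ x ∈ Icc a b, HasDerivWithinAt g₁ (g' x) (Icc a b) x)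
    (h₂ : ∀ x ∈ Icc a b, HasDerivWithinAt g₂ (g' x) (Icc a b) x) (h : g₁ a = g₂ a) :
    EqOn g₁ g₂ (Icc a b) := by
  intro x hx
  have := constant_of_has_deriv_right_zero (f := fun x => g₁ x - g₂ x) (a := a) (b := b)
    (fun y hy => ((h₁ y hy).continuousWithinAt.sub (h₂ y hy).continuousWithinAt))
    (fun y hy => by
      have := ((h₁ y ⟨hy.1, hy.2.le⟩).sub (h₂ y ⟨hy.1, hy.2.le⟩))
      rw [sub_self] at this
      exact this.mono_of_mem_nhdsWithin (Icc_mem_nhdsGE_of_mem hy)) x hx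
  linarith

theorem hasDerivAt_integral_of_continuous {g : ℝ → ℝ} (hg : Continuous g) (x : ℝ) :
    HasDerivAt (fun x => ∫ s in (0:ℝ)..x, g s) (g x) x :=
  intervalIntegral.integral_hasDerivAt_right (hg.intervalIntegrable _ _)
    hg.aestronglyMeasurable.stronglyMeasurableAtFilter hg.continuousAt

theorem locallyLipschitz_of_hasDerivAt {g g' : ℝ → ℝ} (hg : ∀ x, HasDerivAt g (g' x) x)
    (hg' : Continuous g') : LocallyLipschitz g := by
  refine ContDiff.locallyLipschitz (𝕂 := ℝ) (contDiff_one_iff_deriv.2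
    ⟨fun x => (hg x).differentiableAt, ?_⟩)
  rwa [show deriv g = g' from funext fun x => (hg x).deriv]

theorem LocallyLipschitz.real_mul {g₁ g₂ : ℝ → ℝ} (h₁ : LocallyLipschitz g₁)
    (h₂ : LocallyLipschitz g₂) : LocallyLipschitz fun x => g₁ x * g₂ x :=
  (ContDiff.locallyLipschitz (𝕂 := ℝ) (f := fun q : ℝ × ℝ => q.1 * q.2) (by fun_prop)).comp
    (h₁.prodMk h₂)

theorem LocallyLipschitz.real_inv {g : ℝ → ℝ} (h : LocallyLipschitz g) (h0 : ∀ x, g x ≠ 0) :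
    LocallyLipschitz fun x => (g x)⁻¹ := by
  intro x
  obtain ⟨K₁, s, hs, hK₁⟩ := (contDiffAt_inv ℝ (h0 x) (n := 1)).exists_lipschitzOnWith
  obtain ⟨K₂, t, ht, hK₂⟩ := h x
  exact ⟨K₁ * K₂, t ∩ g ⁻¹' s, inter_mem ht (h.continuous.continuousAt.preimage_mem_nhds hs),
    hK₁.comp (hK₂.mono inter_subset_left) fun y hy => hy.2⟩

theorem LocallyLipschitz.exists_lipschitzOnWith_Icc {g : ℝ → ℝ} (h : LocallyLipschitz g)
    (a b : ℝ) : ∃ L : NNReal, LipschitzOnWith L g (Icc a b) :=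
  h.locallyLipschitzOn.exists_lipschitzOnWith_of_compact isCompact_Icc

/-- The projection of the real line onto `[a, b]`. -/
def clampIcc (a b x : ℝ) : ℝ := max a (min x b)

theorem clampIcc_mem {a b : ℝ} (hab : a ≤ b) (x : ℝ) : clampIcc a b x ∈ Icc a b :=
  ⟨le_max_left _ _, max_le hab (min_le_right _ _)⟩

theorem clampIcc_of_mem {a b x : ℝ} (hx : x ∈ Icc a b) : clampIcc a b x = x := by
  rw [clampIcc, min_eq_left hx.2, max_eq_right hx.1]

theorem clampIcc_of_le {a b x : ℝ} (hx : x ≤ a) : clampIcc a b x = a := by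
  rw [clampIcc, max_eq_left ((min_le_left _ _).trans hx)]

theorem clampIcc_of_ge {a b x : ℝ} (hab : a ≤ b) (hx : b ≤ x) : clampIcc a b x = b := by
  rw [clampIcc, min_eq_right hx, max_eq_right hab]

theorem lipschitzWith_clampIcc (a b : ℝ) : LipschitzWith 1 (clampIcc a b) :=
  (LipschitzWith.id.min_const b).const_max a

theorem LipschitzOnWith.comp_clampIcc {g : ℝ → ℝ} {L : NNReal} {a b : ℝ} (hab : a ≤ b)
    (hg : LipschitzOnWith L g (Icc a b)) : LipschitzWith L fun x => g (clampIcc a b x) := by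
  have := hg.comp (lipschitzWith_clampIcc a b).lipschitzOnWith (s := univ)
    fun x _ => clampIcc_mem hab x
  rw [mul_one, lipschitzOnWith_univ] at this
  exact this

/-- A function on `[0, 1]` with Lipschitz derivative extends to the whole line with the derivative
extended by constants. -/
theorem exists_extension {g g' : ℝ → ℝ} {L : NNReal}
    (hg : ∀ x ∈ Icc (0:ℝ) 1, HasDerivWithinAt g (g' x) (Icc 0 1) x)
    (hL : LipschitzOnWith L g' (Icc 0 1)) :
    ∃ G : ℝ → ℝ, (∀ x, HasDerivAt G (g' (clampIcc 0 1 x)) x) ∧ EqOn G g (Icc 0 1) := by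
  have hcont : Continuous fun x => g' (clampIcc 0 1 x) :=
    (hL.comp_clampIcc zero_le_one).continuous
  have hder : ∀ x, HasDerivAt (fun x => g 0 + ∫ s in (0:ℝ)..x, g' (clampIcc 0 1 s))
      (g' (clampIcc 0 1 x)) x := fun x =>
    (hasDerivAt_integral_of_continuous hcont x).const_add _
  refine ⟨_, hder, eqOn_Icc_of_hasDerivWithinAt (fun x hx => (hder x).hasDerivWithinAt)
    (fun x hx => ?_) (by simp)⟩
  rw [clampIcc_of_mem hx]
  exact hg x hx

theorem exists_transport_profile {c : ℝ} (hc : 0 < c) {u z z' : ℝ → ℝ} {L L' : NNReal}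
    (hu : LipschitzOnWith L u (Icc 0 1)) (hu0 : ∀ x ∈ Icc (0:ℝ) 1, 0 < u x)
    (hz : ∀ x ∈ Icc (0:ℝ) 1, HasDerivWithinAt z (z' x) (Icc 0 1) x)
    (hL' : LipschitzOnWith L' z' (Icc 0 1)) (hz0 : z' 0 = 0) :
    ∃ G Z Z' : ℝ → ℝ, G 0 = 0 ∧ (∀ x, HasDerivAt G (1 / (c + u (clampIcc 0 1 x))) x) ∧
      (∀ η, HasDerivAt Z (Z' η) η) ∧ LocallyLipschitz Z' ∧
      (∀ x ∈ Icc (0:ℝ) 1, Z (-G x) = z x) ∧ ∀ η ≥ 0, Z η = z 0 := by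
  have hclamp := hu.comp_clampIcc zero_le_one
  have hupos : ∀ x, 0 < u (clampIcc 0 1 x) := fun x => hu0 _ (clampIcc_mem zero_le_one x)
  obtain ⟨M, hM⟩ := (isCompact_Icc (a := (0:ℝ)) (b := 1)).exists_bound_of_continuousOn
    hu.continuousOn
  have hM0 : 0 ≤ M := (norm_nonneg _).trans (hM 0 ⟨le_rfl, zero_le_one⟩)
  have hFLip : LipschitzWith L fun x => c + u (clampIcc 0 1 x) := by
    refine LipschitzWith.of_dist_le_mul fun x y => ?_
    rw [dist_add_left]
    exact hclamp.dist_le_mul x y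
  obtain ⟨S, hS0, hS⟩ := exists_hasDerivAt_of_lipschitzWith_of_bounded hFLip
    (L := ⟨c + M, by positivity⟩) (fun x => by
      have h1 := hM _ (clampIcc_mem zero_le_one x)
      have h2 := hupos x
      rw [Real.norm_of_nonneg h2.le] at h1
      rw [Real.norm_of_nonneg (by linarith)]
      exact add_le_add_right h1 c) 0
  have hGcont : Continuous fun x => 1 / (c + u (clampIcc 0 1 x)) :=
    continuous_const.div (continuous_const.add hclamp.continuous)
      fun x => by have := hupos x; positivity
  have hG := hasDerivAt_integral_of_continuous hGcont
  set G : ℝ → ℝ := fun x => ∫ s in (0:ℝ)..x, 1 / (c + u (clampIcc 0 1 s)) with hGdef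
  have hG0 : G 0 = 0 := by simp [hGdef]
  have hGmono : StrictMono G := strictMono_of_deriv_pos fun x => by
    rw [(hG x).deriv]
    have := hupos x
    positivity
  have hGS : ∀ y, G (S y) = y := by
    have hder : ∀ y, HasDerivAt (fun y => G (S y) - y) 0 y := by
      intro y
      have := ((hG (S y)).comp y (hS y)).sub (hasDerivAt_id y)
      have h2 := hupos (S y)
      rw [one_div_mul_cancel (by positivity), sub_self] at this
      exact this
    intro y
    have := is_const_of_deriv_eq_zero (fun y => (hder y).differentiableAt)
      (fun y => (hder y).deriv) y 0
    rw [hS0, hG0] at this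
    linarith
  have hSG : ∀ x, S (G x) = x := fun x => hGmono.injective (hGS (G x))
  obtain ⟨ze, hze, hzeq⟩ := exists_extension hz hL'
  have hSlip : LocallyLipschitz S := locallyLipschitz_of_hasDerivAt hS
    (hFLip.continuous.comp (continuous_iff_continuousAt.2 fun x => (hS x).continuousAt))
  have hSneg : LocallyLipschitz fun η => S (-η) := hSlip.comp LocallyLipschitz.id.neg
  refine ⟨G, fun η => ze (S (-η)),
    fun η => z' (clampIcc 0 1 (S (-η))) * ((c + u (clampIcc 0 1 (S (-η)))) * -1), hG0, hG,
    fun η => ?_, ?_, fun x hx => ?_, fun η hη => ?_⟩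
  · exact (hze (S (-η))).comp η ((hS (-η)).comp η (hasDerivAt_neg η))
  · exact ((hL'.comp_clampIcc zero_le_one).locallyLipschitz.comp hSneg).real_mul
      ((hFLip.locallyLipschitz.comp hSneg).real_mul (LocallyLipschitz.const _))
  · simp only [neg_neg, hSG]
    exact hzeq hx
  · have hs : S (-η) ≤ 0 := by
      rw [← hGmono.le_iff_le, hGS, hG0]
      linarith
    have := eqOn_Icc_of_hasDerivWithinAt (g₁ := fun _ => ze (S (-η))) (g₂ := ze)
      (g' := fun _ => 0) (a := S (-η)) (b := 0) (fun x _ => hasDerivWithinAt_const _ _ _)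
      (fun x hx => by
        have := hze x
        rw [clampIcc_of_le hx.2, hz0] at this
        exact this.hasDerivWithinAt) rfl (right_mem_Icc.2 hs)
    exact this.trans (hzeq ⟨le_rfl, zero_le_one⟩)

/-- The outlet dynamics: velocity at the outlet coupled with the label of the characteristic
arriving there. -/
theorem exists_outlet_dynamics {c μ V₀ E₀ : ℝ} (hc : 0 < c) (hμ : 0 < μ) (hV₀ : 0 < V₀)
    (hE₀ : E₀ ≤ 0) {f Z Z' : ℝ → ℝ} (hf1 : ContDiffOn ℝ 1 f (Ici 0))
    (hfpos : ∀ x ∈ Ici (0:ℝ), 0 < f x) (hfbdd : ∃ M, ∀ x ∈ Ici (0:ℝ), f x ≤ M)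
    (hZ : ∀ η, HasDerivAt Z (Z' η) η) (hZ' : Continuous Z') (hZ0 : ∀ η ≥ 0, Z η = Z 0)
    (hZpos : ∀ η ≥ E₀, 0 < Z η) :
    ∃ V V' E : ℝ → ℝ, V 0 = V₀ ∧ E 0 = E₀ ∧ LocallyLipschitz V' ∧
      (∀ t ≥ 0, 0 < V t ∧ HasDerivAt V (V' t) t ∧
        V' t = -μ * (V t - f (Z (E t) / (c + V t))) ∧ HasDerivAt E (V t / (c + V t)) t) := by
  obtain ⟨M₀, hM₀⟩ := hfbdd
  set M := max V₀ M₀ with hMdef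
  have hM : 0 < M := hV₀.trans_le (le_max_left _ _)
  set D : Set (ℝ × ℝ) := Icc 0 M ×ˢ Icc E₀ 0 with hD
  have hDcomp : IsCompact D := isCompact_Icc.prod isCompact_Icc
  have hDconv : Convex ℝ D := (convex_Icc _ _).prod (convex_Icc _ _)
  have hZ1 : ContDiff ℝ 1 Z := contDiff_one_iff_deriv.2 ⟨fun x => (hZ x).differentiableAt, by
    rwa [show deriv Z = Z' from funext fun x => (hZ x).deriv]⟩
  have hden : ∀ q ∈ D, c + q.1 ≠ 0 := fun q hq => by
    have := hq.1.1
    positivity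
  have harg : ∀ q ∈ D, Z q.2 / (c + q.1) ∈ Ici (0:ℝ) := fun q hq =>
    div_nonneg (hZpos _ hq.2.1).le (add_nonneg hc.le hq.1.1)
  set Φ : ℝ × ℝ → ℝ × ℝ := fun q => (-μ * (q.1 - f (Z q.2 / (c + q.1))), q.1 / (c + q.1)) with hΦ
  have h1 : ContDiffOn ℝ 1 (fun q : ℝ × ℝ => c + q.1) D := by fun_prop
  have h2 : ContDiffOn ℝ 1 (fun q : ℝ × ℝ => Z q.2 / (c + q.1)) D :=
    (hZ1.comp contDiff_snd).contDiffOn.div h1 hden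
  have h3 : ContDiffOn ℝ 1 (fun q : ℝ × ℝ => f (Z q.2 / (c + q.1))) D := hf1.comp h2 harg
  have hΦ1 : ContDiffOn ℝ 1 Φ D := (contDiffOn_const.mul (contDiff_fst.contDiffOn.sub h3)).prodMk
    (contDiff_fst.contDiffOn.div h1 hden)
  obtain ⟨L, hL⟩ := (hΦ1.locallyLipschitzOn hDconv).exists_lipschitzOnWith_of_compact hDcomp
  obtain ⟨B, hB⟩ := hDcomp.exists_bound_of_continuousOn hΦ1.continuousOn
  set cl : ℝ × ℝ → ℝ × ℝ := fun q => (clampIcc 0 M q.1, clampIcc E₀ 0 q.2) with hcl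
  have hclmem : ∀ q, cl q ∈ D := fun q => ⟨clampIcc_mem hM.le _, clampIcc_mem hE₀ _⟩
  have hcllip : LipschitzWith 1 cl := by
    have := ((lipschitzWith_clampIcc 0 M).comp LipschitzWith.prod_fst).prodMk
      ((lipschitzWith_clampIcc E₀ 0).comp LipschitzWith.prod_snd)
    simpa using this
  have hF : LipschitzWith L (Φ ∘ cl) := by
    have := hL.comp (hcllip.lipschitzOnWith (s := univ)) fun x _ => hclmem x
    rwa [mul_one, lipschitzOnWith_univ] at this
  have hB0 : 0 ≤ B := (norm_nonneg _).trans (hB _ (hclmem (0, 0)))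
  obtain ⟨γ, hγ0, hγ⟩ := exists_hasDerivAt_of_lipschitzWith_of_bounded hF (L := ⟨B, hB0⟩)
    (fun x => hB _ (hclmem x)) (V₀, E₀)
  have hγV : ∀ t, HasDerivAt (fun t => (γ t).1) ((Φ (cl (γ t))).1) t := fun t =>
    (hasFDerivAt_fst (𝕜 := ℝ) (p := γ t)).comp_hasDerivAt t (hγ t)
  have hγE : ∀ t, HasDerivAt (fun t => (γ t).2) ((Φ (cl (γ t))).2) t := fun t =>
    (hasFDerivAt_snd (𝕜 := ℝ) (p := γ t)).comp_hasDerivAt t (hγ t)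
  have hE : ∀ t ≥ 0, E₀ ≤ (γ t).2 := by
    have := le_of_barrier (y := fun t => -(γ t).2) (B := fun _ => -E₀) (t₀ := 0)
      (fun t _ => (hγE t).neg) (fun t _ => hasDerivAt_const t _) (by simp [hγ0])
      (fun t _ _ => by
        have h1 := (hclmem (γ t)).1.1
        have : 0 ≤ (cl (γ t)).1 / (c + (cl (γ t)).1) := by positivity
        simpa [hΦ] using this)
    intro t ht
    linarith [this t ht]
  obtain ⟨q₀, hq₀, hmin⟩ := hDcomp.exists_isMinOn ⟨_, hclmem (0, 0)⟩ h3.continuousOn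
  set b := min V₀ (f (Z q₀.2 / (c + q₀.1))) with hb
  have hb0 : 0 < b := lt_min hV₀ (hfpos _ (harg q₀ hq₀))
  have hlow : ∀ t ≥ 0, b ≤ (γ t).1 := by
    have := le_of_barrier (y := fun t => -(γ t).1) (B := fun _ => -b) (t₀ := 0)
      (fun t _ => (hγV t).neg) (fun t _ => hasDerivAt_const t _)
      (by simp [hγ0, hb])
      (fun t _ hlt => by
        have h4 : (cl (γ t)).1 ≤ b :=
          max_le hb0.le ((min_le_left _ _).trans (neg_lt_neg_iff.1 hlt).le)
        have h5 : b ≤ f (Z (cl (γ t)).2 / (c + (cl (γ t)).1)) :=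
          (min_le_right _ _).trans (hmin (hclmem (γ t)))
        have : 0 ≤ μ * (f (Z (cl (γ t)).2 / (c + (cl (γ t)).1)) - (cl (γ t)).1) :=
          mul_nonneg hμ.le (by linarith)
        simp only [hΦ]
        linarith)
    intro t ht
    linarith [this t ht]
  have hup : ∀ t ≥ 0, (γ t).1 ≤ M := by
    refine le_of_barrier (y := fun t => (γ t).1) (B := fun _ => M) (t₀ := 0)
      (fun t _ => hγV t) (fun t _ => hasDerivAt_const t _) (by simp [hγ0, hMdef])
      (fun t _ hlt => ?_)
    have h4 : (cl (γ t)).1 = M := clampIcc_of_ge hM.le hlt.le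
    have h5 : f (Z (cl (γ t)).2 / (c + (cl (γ t)).1)) ≤ M :=
      (hM₀ _ (harg _ (hclmem (γ t)))).trans (le_max_right _ _)
    have : 0 ≤ μ * ((cl (γ t)).1 - f (Z (cl (γ t)).2 / (c + (cl (γ t)).1))) :=
      mul_nonneg hμ.le (by linarith)
    simp only [hΦ]
    linarith
  have hγcont : Continuous γ := continuous_iff_continuousAt.2 fun t => (hγ t).continuousAt
  refine ⟨fun t => (γ t).1, fun t => (Φ (cl (γ t))).1, fun t => (γ t).2, by simp [hγ0],
    by simp [hγ0], ?_, fun t ht => ?_⟩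
  · have hΦcont : Continuous fun t => Φ (cl (γ t)) := hF.continuous.comp hγcont
    exact (LipschitzWith.prod_fst.comp hF).locallyLipschitz.comp
      ((locallyLipschitz_of_hasDerivAt hγV hΦcont.fst).prodMk
        (locallyLipschitz_of_hasDerivAt hγE hΦcont.snd))
  · have h4 : (cl (γ t)).1 = (γ t).1 := clampIcc_of_mem ⟨hb0.le.trans (hlow t ht), hup t ht⟩
    have h5 : Z (cl (γ t)).2 = Z (γ t).2 := by
      rcases le_total (γ t).2 0 with h | h
      · rw [show (cl (γ t)).2 = (γ t).2 from clampIcc_of_mem ⟨hE t ht, h⟩]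
      · rw [show (cl (γ t)).2 = 0 from clampIcc_of_ge hE₀ h, hZ0 _ h]
    have h6 := hγE t
    simp only [hΦ, h4, h5] at h6 ⊢
    refine ⟨hb0.trans_le (hlow t ht), ?_, trivial, h6⟩
    have h7 := hγV t
    simp only [hΦ, h4, h5] at h7
    exact h7

/-- The one-variable functions from which a closed-loop solution is assembled:
`v(t, x) = φ(ct + x)` and `ρ(t, x) = Z(t - G(ct + x)) / (c + φ(ct + x))`. -/
structure ClosedLoopProfile (c μ ρeq : ℝ) (f ρ₀ v₀ φ p G Z Z' : ℝ → ℝ) : Prop where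
  hasDerivAt_velocity : ∀ s, HasDerivAt φ (p s) s
  locallyLipschitz_velocity : LocallyLipschitz p
  velocity_pos : ∀ s ≥ 0, 0 < φ s
  hasDerivAt_travel : ∀ s ≥ 0, HasDerivAt G (1 / (c + φ s)) s
  travel_zero : G 0 = 0
  hasDerivAt_invariant : ∀ η, HasDerivAt Z (Z' η) η
  locallyLipschitz_invariant : LocallyLipschitz Z'
  invariant_eq : ∀ η ≥ 0, Z η = ρeq * (c + f ρeq)
  velocity_initial : ∀ x ∈ Icc (0:ℝ) 1, φ x = v₀ x
  invariant_initial : ∀ x ∈ Icc (0:ℝ) 1, Z (-G x) = ρ₀ x * (c + v₀ x)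
  outlet : ∀ t ≥ 0, c * p (c * t + 1) =
    -μ * (φ (c * t + 1) - f (Z (t - G (c * t + 1)) / (c + φ (c * t + 1))))

theorem exists_velocity_profile {c : ℝ} (hc : 0 < c) {v₀ v' V V' : ℝ → ℝ} {L : NNReal}
    (hv : ∀ x ∈ Icc (0:ℝ) 1, HasDerivWithinAt v₀ (v' x) (Icc 0 1) x)
    (hL : LipschitzOnWith L v' (Icc 0 1)) (hV' : LocallyLipschitz V')
    (hV : ∀ t ≥ 0, HasDerivAt V (V' t) t) (hV0 : V 0 = v₀ 1) (hcompat : c * v' 1 = V' 0) :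
    ∃ φ p : ℝ → ℝ, (∀ s, HasDerivAt φ (p s) s) ∧ LocallyLipschitz p ∧
      (∀ x ∈ Icc (0:ℝ) 1, φ x = v₀ x) ∧ (∀ t ≥ 0, φ (c * t + 1) = V t) ∧
      ∀ t ≥ 0, c * p (c * t + 1) = V' t := by
  set p : ℝ → ℝ := fun s => v' (clampIcc 0 1 s) + c⁻¹ * (V' (max 0 (c⁻¹ * (s - 1))) + -V' 0)
    with hp
  have hplip : LocallyLipschitz p := by
    have h1 : LocallyLipschitz fun s : ℝ => max 0 (c⁻¹ * (s - 1)) :=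
      (ContDiff.locallyLipschitz (𝕂 := ℝ) (f := fun s : ℝ => c⁻¹ * (s - 1))
        (by fun_prop)).const_max 0
    exact (hL.comp_clampIcc zero_le_one).locallyLipschitz.add
      ((LocallyLipschitz.const _).real_mul ((hV'.comp h1).add (LocallyLipschitz.const _)))
  have hder : ∀ s, HasDerivAt (fun s => v₀ 0 + ∫ σ in (0:ℝ)..s, p σ) (p s) s := fun s =>
    (hasDerivAt_integral_of_continuous hplip.continuous s).const_add _
  have hpV : ∀ t ≥ 0, c * p (c * t + 1) = V' t := by
    intro t ht
    have h1 : c⁻¹ * (c * t + 1 - 1) = t := by field_simp; ring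
    have h2 : 1 ≤ c * t + 1 := by have := mul_nonneg hc.le ht; linarith
    simp only [hp]
    rw [h1, max_eq_right ht, clampIcc_of_ge zero_le_one h2, mul_add, hcompat]
    field_simp
    ring
  set φ := fun s => v₀ 0 + ∫ σ in (0:ℝ)..s, p σ with hφ
  have hφ0 : EqOn φ v₀ (Icc 0 1) := by
    refine eqOn_Icc_of_hasDerivWithinAt (fun x _ => (hder x).hasDerivWithinAt)
      (fun x hx => ?_) (by simp [hφ])
    have h1 : c⁻¹ * (x - 1) ≤ 0 :=
      mul_nonpos_of_nonneg_of_nonpos (inv_nonneg.2 hc.le) (by linarith [hx.2])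
    simp only [hp]
    rw [max_eq_left h1, clampIcc_of_mem hx, add_neg_cancel, mul_zero, add_zero]
    exact hv x hx
  refine ⟨φ, p, hder, hplip, hφ0, fun t ht => ?_, hpV⟩
  refine eqOn_Icc_of_hasDerivWithinAt (g₁ := fun t => φ (c * t + 1)) (g₂ := V) (g' := V')
    (a := 0) (b := t) (fun s hs => ?_) (fun s hs => (hV s hs.1).hasDerivWithinAt) ?_
    (right_mem_Icc.2 ht)
  · rw [← hpV s hs.1, mul_comm c (p _)]
    have h1 : HasDerivAt (fun s => c * s + 1) c s := by
      simpa using ((hasDerivAt_id s).const_mul c).add_const 1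
    exact ((hder (c * s + 1)).comp s h1).hasDerivWithinAt
  · simp only [mul_zero, zero_add]
    rw [hφ0 ⟨zero_le_one, le_rfl⟩, hV0]

theorem exists_initial_label {G : ℝ → ℝ} (hG : ContinuousOn G (Icc 0 1)) (hG0 : G 0 = 0) {η : ℝ}
    (h1 : -G 1 ≤ η) (h0 : η ≤ 0) : ∃ x ∈ Icc (0:ℝ) 1, -G x = η :=
  intermediate_value_Icc' zero_le_one hG.neg ⟨h1, by simpa [hG0] using h0⟩

theorem exists_closedLoopProfile {c μ ρeq : ℝ} (hc : 0 < c) (hμ : 0 < μ)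
    {f h ρ₀ v₀ ρ₀' v₀' : ℝ → ℝ} (hw : 0 < f ρeq) (hf1 : ContDiffOn ℝ 1 f (Ici 0))
    (hfpos : ∀ x ∈ Ici (0:ℝ), 0 < f x) (hfbdd : ∃ M, ∀ x ∈ Ici (0:ℝ), f x ≤ M)
    (hX : MemX c μ f h ρ₀ v₀)
    (hρ₀' : ∀ x ∈ Icc (0:ℝ) 1, HasDerivWithinAt ρ₀ (ρ₀' x) (Icc 0 1) x)
    (hv₀' : ∀ x ∈ Icc (0:ℝ) 1, HasDerivWithinAt v₀ (v₀' x) (Icc 0 1) x)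
    (hρ0 : ρ₀ 0 = ρeq * (c + f ρeq) / (c + v₀ 0))
    (hρ₀der : ρ₀' 0 = -(ρ₀ 0 / (c + v₀ 0)) * v₀' 0) :
    ∃ φ p G Z Z' : ℝ → ℝ, ClosedLoopProfile c μ ρeq f ρ₀ v₀ φ p G Z Z' := by
  obtain ⟨ρ', v', hρ, hv, ⟨Lρ, hLρ⟩, ⟨Lv, hLv⟩, hpos, hout, -⟩ := hX
  have h0mem : (0:ℝ) ∈ Icc (0:ℝ) 1 := ⟨le_rfl, zero_le_one⟩
  have h1mem : (1:ℝ) ∈ Icc (0:ℝ) 1 := ⟨zero_le_one, le_rfl⟩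
  have huniq := (uniqueDiffOn_Icc_zero_one (0:ℝ) h0mem)
  have hρder : ρ' 0 = -(ρ₀ 0 / (c + v₀ 0)) * v' 0 := by
    rw [huniq.eq_deriv _ (hρ 0 h0mem) (hρ₀' 0 h0mem), hρ₀der,
      huniq.eq_deriv _ (hv 0 h0mem) (hv₀' 0 h0mem)]
  obtain ⟨ρe, hρe, hρeq'⟩ := exists_extension hρ hLρ
  obtain ⟨ve, hve, hveq⟩ := exists_extension hv hLv
  have hρ'c := hLρ.comp_clampIcc zero_le_one
  have hv'c := hLv.comp_clampIcc zero_le_one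
  have hρelip := locallyLipschitz_of_hasDerivAt hρe hρ'c.continuous
  have hvelip := locallyLipschitz_of_hasDerivAt hve hv'c.continuous
  obtain ⟨Lu, hLu⟩ := hvelip.exists_lipschitzOnWith_Icc 0 1
  have hLu' : LipschitzOnWith Lu v₀ (Icc 0 1) := fun x hx y hy => by
    rw [← hveq hx, ← hveq hy]
    exact hLu hx hy
  obtain ⟨Lz, hLz⟩ := ((hρ'c.locallyLipschitz.real_mul
    ((LocallyLipschitz.const c).add hvelip)).add
      (hρelip.real_mul hv'c.locallyLipschitz)).exists_lipschitzOnWith_Icc 0 1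
  have hLz' : LipschitzOnWith Lz (fun x => ρ' x * (c + v₀ x) + ρ₀ x * v' x) (Icc 0 1) :=
    fun x hx y hy => by
      have := hLz hx hy
      simpa only [clampIcc_of_mem hx, clampIcc_of_mem hy, hveq hx, hveq hy, hρeq' hx, hρeq' hy,
        Pi.add_apply] using this
  have hv00 := (hpos 0 h0mem).2
  obtain ⟨G₀, Z, Z', hG₀0, hG₀, hZ, hZ'lip, hZ0, hZK⟩ := exists_transport_profile
    (z := fun x => ρ₀ x * (c + v₀ x)) hc hLu'
    (fun x hx => (hpos x hx).2) (fun x hx => (hρ x hx).mul ((hv x hx).const_add c)) hLz' (by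
      rw [hρder]
      field_simp
      ring)
  have hK : ρ₀ 0 * (c + v₀ 0) = ρeq * (c + f ρeq) := by
    rw [hρ0]
    field_simp
  have hG₀mono : StrictMono G₀ := strictMono_of_deriv_pos fun x => by
    rw [(hG₀ x).deriv]
    have := (hpos _ (clampIcc_mem zero_le_one x)).2
    positivity
  have hZpos : ∀ η ≥ -G₀ 1, 0 < Z η := by
    intro η hη
    rcases le_total η 0 with h | h
    · obtain ⟨x, hx, rfl⟩ := exists_initial_label
        (fun x _ => (hG₀ x).continuousAt.continuousWithinAt) hG₀0 hη h
      rw [hZ0 x hx]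
      have := hpos x hx
      exact mul_pos this.1 (by linarith)
    · rw [hZK η h]
      exact mul_pos (hpos 0 h0mem).1 (by linarith)
  have hZK0 : ∀ η ≥ 0, Z η = Z 0 := fun η hη => by rw [hZK η hη, hZK 0 le_rfl]
  have hv1 := (hpos 1 h1mem).2
  obtain ⟨V, V', E, hV0, hE0, hV'lip, hVE⟩ := exists_outlet_dynamics hc hμ hv1
    (neg_nonpos.2 (hG₀0 ▸ (hG₀mono.le_iff_le.2 zero_le_one : G₀ 0 ≤ G₀ 1))) hf1 hfpos hfbdd hZ
    hZ'lip.continuous hZK0 hZpos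
  obtain ⟨φ, p, hφ, hp, hφ0, hφV, hpV⟩ := exists_velocity_profile hc hv hLv hV'lip
    (fun t ht => (hVE t ht).2.1) hV0 (by
      rw [hout, (hVE 0 le_rfl).2.2.1, hV0, hE0, hZ0 1 h1mem, mul_div_assoc, div_self (by positivity),
        mul_one])
  have hφpos : ∀ s ≥ 0, 0 < φ s := by
    intro s hs
    rcases le_total s 1 with h | h
    · rw [hφ0 s ⟨hs, h⟩]
      exact (hpos s ⟨hs, h⟩).2
    · have h1 : (0:ℝ) ≤ (s - 1) / c := div_nonneg (by linarith) hc.le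
      have h2 := hφV _ h1
      rw [mul_div_cancel₀ _ hc.ne', sub_add_cancel] at h2
      rw [h2]
      exact (hVE _ h1).1
  have hφcont : Continuous φ := continuous_iff_continuousAt.2 fun x => (hφ x).continuousAt
  have hg : Continuous fun s => 1 / (c + φ (max s 0)) :=
    continuous_const.div (by fun_prop) fun s => by
      have := hφpos _ (le_max_right s 0)
      positivity
  have hG := hasDerivAt_integral_of_continuous hg
  set G : ℝ → ℝ := fun x => ∫ s in (0:ℝ)..x, 1 / (c + φ (max s 0)) with hGdef
  have hG' : ∀ s ≥ 0, HasDerivAt G (1 / (c + φ s)) s := by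
    intro s hs
    have := hG s
    rwa [max_eq_left hs] at this
  have hG0 : G 0 = 0 := by simp [hGdef]
  have hGG₀ : EqOn G G₀ (Icc 0 1) := by
    refine eqOn_Icc_of_hasDerivWithinAt (fun x hx => (hG' x hx.1).hasDerivWithinAt)
      (fun x hx => ?_) (hG0.trans hG₀0.symm)
    have := hG₀ x
    rw [clampIcc_of_mem hx, ← hφ0 x hx] at this
    exact this.hasDerivWithinAt
  have hEG : ∀ t ≥ 0, t - G (c * t + 1) = E t := by
    intro t ht
    refine eqOn_Icc_of_hasDerivWithinAt (g₁ := fun t => t - G (c * t + 1)) (g₂ := E)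
      (g' := fun t => V t / (c + V t)) (a := 0) (b := t) (fun s hs => ?_)
      (fun s hs => (hVE s hs.1).2.2.2.hasDerivWithinAt) ?_ (right_mem_Icc.2 ht)
    · have h1 : HasDerivAt (fun s => c * s + 1) c s := by
        simpa using ((hasDerivAt_id s).const_mul c).add_const 1
      have h2 : 0 ≤ c * s + 1 := by have := mul_nonneg hc.le hs.1; linarith
      have h3 := (hasDerivAt_id s).sub ((hG' _ h2).comp s h1)
      have hVs := (hVE s hs.1).1
      rw [hφV s hs.1, show 1 - 1 / (c + V s) * c = V s / (c + V s) by field_simp; ring] at h3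
      exact h3.hasDerivWithinAt
    · simp only [mul_zero, zero_add, zero_sub]
      rw [hGG₀ h1mem, hE0]
  refine ⟨φ, p, G, Z, Z', hφ, hp, hφpos, hG', hG0, hZ, hZ'lip, fun η hη => (hZK η hη).trans hK,
    hφ0, fun x hx => ?_, fun t ht => ?_⟩
  · rw [hGG₀ hx, hZ0 x hx]
  · rw [hpV t ht, hEG t ht, hφV t ht]
    exact (hVE t ht).2.2.1

/-- The density of the solution assembled from a profile. -/
noncomputable def profileDensity (c : ℝ) (φ G Z : ℝ → ℝ) (t x : ℝ) : ℝ :=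
  Z (t - G (c * t + x)) * (c + φ (c * t + x))⁻¹

/-- The time derivative of `profileDensity`. -/
noncomputable def profileDensityTime (c : ℝ) (φ p G Z Z' : ℝ → ℝ) (t x : ℝ) : ℝ :=
  Z' (t - G (c * t + x)) * (1 - (c + φ (c * t + x))⁻¹ * c) * (c + φ (c * t + x))⁻¹ +
    Z (t - G (c * t + x)) * (-(p (c * t + x) * c) *
      ((c + φ (c * t + x))⁻¹ * (c + φ (c * t + x))⁻¹))

/-- The space derivative of `profileDensity`. -/
noncomputable def profileDensitySpace (c : ℝ) (φ p G Z Z' : ℝ → ℝ) (t x : ℝ) : ℝ :=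
  Z' (t - G (c * t + x)) * (-(c + φ (c * t + x))⁻¹) * (c + φ (c * t + x))⁻¹ +
    Z (t - G (c * t + x)) * (-p (c * t + x) *
      ((c + φ (c * t + x))⁻¹ * (c + φ (c * t + x))⁻¹))

namespace ClosedLoopProfile

variable {c μ ρeq ρmax ε : ℝ} {f h ρ₀ v₀ φ p G Z Z' : ℝ → ℝ}

theorem lipschitzOnWith_travel (P : ClosedLoopProfile c μ ρeq f ρ₀ v₀ φ p G Z Z') (hc : 0 < c) :
    LipschitzOnWith (NNReal.mk (1 / c) (by positivity)) G (Ici 0) := by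
  refine (convex_Ici 0).lipschitzOnWith_of_nnnorm_hasDerivWithin_le
    (fun s hs => (P.hasDerivAt_travel s hs).hasDerivWithinAt) fun s hs => ?_
  have := P.velocity_pos s hs
  rw [← NNReal.coe_le_coe, coe_nnnorm, Real.norm_of_nonneg (by positivity)]
  exact one_div_le_one_div_of_le hc (by linarith)

theorem travel_le_travel (P : ClosedLoopProfile c μ ρeq f ρ₀ v₀ φ p G Z Z') (hc : 0 < c) {r s : ℝ}
    (hr : 0 ≤ r) (hrs : r ≤ s) : G r ≤ G s :=
  le_of_barrier (y := fun _ => G r) (B := G) (t₀ := r) (fun t _ => hasDerivAt_const t _)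
    (fun t ht => P.hasDerivAt_travel t (hr.trans ht)) le_rfl
    (fun t ht _ => by
      have := P.velocity_pos t (hr.trans ht)
      positivity) s hrs

theorem travel_le_add (P : ClosedLoopProfile c μ ρeq f ρ₀ v₀ φ p G Z Z') (hc : 0 < c) {r s : ℝ}
    (hr : 0 ≤ r) (hrs : r ≤ s) : G s ≤ G r + (s - r) / c := by
  have := (P.lipschitzOnWith_travel hc).dist_le_mul s (hr.trans hrs) r hr
  rw [Real.dist_eq, Real.dist_eq, abs_of_nonneg (sub_nonneg.2 hrs), NNReal.coe_mk,
    one_div_mul_eq_div] at this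
  linarith [le_abs_self (G s - G r)]

theorem neg_travel_le_label (P : ClosedLoopProfile c μ ρeq f ρ₀ v₀ φ p G Z Z') (hc : 0 < c)
    {t x : ℝ} (ht : 0 ≤ t) (hx : x ∈ Icc (0:ℝ) 1) : -G 1 ≤ t - G (c * t + x) := by
  have h1 := P.travel_le_travel hc hx.1 hx.2
  have h2 := P.travel_le_add hc hx.1 (by nlinarith : x ≤ c * t + x)
  rw [add_sub_cancel_right, mul_div_cancel_left₀ _ hc.ne'] at h2
  linarith

theorem inlet_label_nonneg (P : ClosedLoopProfile c μ ρeq f ρ₀ v₀ φ p G Z Z') (hc : 0 < c)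
    {t : ℝ} (ht : 0 ≤ t) : 0 ≤ t - G (c * t + 0) := by
  have h2 := P.travel_le_add hc le_rfl (by positivity : 0 ≤ c * t + 0)
  rw [sub_zero, add_zero, mul_div_cancel_left₀ _ hc.ne', P.travel_zero] at h2
  rw [add_zero]
  linarith

theorem exists_invariant_eq (P : ClosedLoopProfile c μ ρeq f ρ₀ v₀ φ p G Z Z') {η : ℝ}
    (hη : -G 1 ≤ η) : ∃ x ∈ Icc (0:ℝ) 1, Z η = ρ₀ x * (c + v₀ x) := by
  rcases le_total η 0 with h | h
  · obtain ⟨x, hx, rfl⟩ := exists_initial_label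
      (fun x hx => (P.hasDerivAt_travel x hx.1).continuousAt.continuousWithinAt) P.travel_zero hη h
    exact ⟨x, hx, P.invariant_initial x hx⟩
  · refine ⟨0, ⟨le_rfl, zero_le_one⟩, ?_⟩
    rw [← P.invariant_initial 0 ⟨le_rfl, zero_le_one⟩, P.travel_zero, neg_zero,
      P.invariant_eq 0 le_rfl, P.invariant_eq η h]

theorem invariant_pos (P : ClosedLoopProfile c μ ρeq f ρ₀ v₀ φ p G Z Z') (hc : 0 < c)
    (hpos : ∀ x ∈ Icc (0:ℝ) 1, 0 < ρ₀ x ∧ 0 < v₀ x) {η : ℝ} (hη : -G 1 ≤ η) : 0 < Z η := by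
  obtain ⟨x, hx, h⟩ := P.exists_invariant_eq hη
  have := hpos x hx
  rw [h]
  exact mul_pos this.1 (by linarith)

theorem nonneg_phase (hc : 0 < c) {t x : ℝ} (ht : 0 ≤ t) (hx : x ∈ Icc (0:ℝ) 1) :
    0 ≤ c * t + x := add_nonneg (mul_nonneg hc.le ht) hx.1

theorem density_pos (P : ClosedLoopProfile c μ ρeq f ρ₀ v₀ φ p G Z Z') (hc : 0 < c)
    (hpos : ∀ x ∈ Icc (0:ℝ) 1, 0 < ρ₀ x ∧ 0 < v₀ x) {t x : ℝ} (ht : 0 ≤ t)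
    (hx : x ∈ Icc (0:ℝ) 1) : 0 < profileDensity c φ G Z t x := by
  have := P.velocity_pos _ (nonneg_phase hc ht hx)
  exact mul_pos (P.invariant_pos hc hpos (P.neg_travel_le_label hc ht hx)) (by positivity)

theorem density_mul (P : ClosedLoopProfile c μ ρeq f ρ₀ v₀ φ p G Z Z') (hc : 0 < c)
    {t x : ℝ} (ht : 0 ≤ t) (hx : x ∈ Icc (0:ℝ) 1) :
    profileDensity c φ G Z t x * (c + φ (c * t + x)) = Z (t - G (c * t + x)) := by
  have := P.velocity_pos _ (nonneg_phase hc ht hx)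
  exact inv_mul_cancel_right₀ (by positivity) _

theorem density_inlet (P : ClosedLoopProfile c μ ρeq f ρ₀ v₀ φ p G Z Z') (hc : 0 < c)
    {t : ℝ} (ht : 0 ≤ t) :
    profileDensity c φ G Z t 0 = ρeq * (c + f ρeq) / (c + φ (c * t + 0)) := by
  rw [profileDensity, P.invariant_eq _ (P.inlet_label_nonneg hc ht), div_eq_mul_inv]

theorem hasDerivAt_density_time (P : ClosedLoopProfile c μ ρeq f ρ₀ v₀ φ p G Z Z') (hc : 0 < c)
    {t x : ℝ} (ht : 0 ≤ t) (hx : x ∈ Icc (0:ℝ) 1) :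
    HasDerivAt (fun t => profileDensity c φ G Z t x) (profileDensityTime c φ p G Z Z' t x) t := by
  have hs := nonneg_phase hc ht hx
  have hN : c + φ (c * t + x) ≠ 0 := by have := P.velocity_pos _ hs; positivity
  have h1 : HasDerivAt (fun t => c * t + x) c t := by
    simpa using ((hasDerivAt_id t).const_mul c).add_const x
  have h2 := (P.hasDerivAt_invariant (t - G (c * t + x))).comp t
    ((hasDerivAt_id t).sub ((P.hasDerivAt_travel _ hs).comp t h1))
  have h3 := (((P.hasDerivAt_velocity (c * t + x)).comp t h1).const_add c).inv hN
  refine (h2.mul h3).congr_deriv ?_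
  simp only [profileDensityTime, Function.comp_apply, Pi.sub_apply, Pi.inv_apply, id_eq]
  field_simp

theorem hasDerivAt_density_space (P : ClosedLoopProfile c μ ρeq f ρ₀ v₀ φ p G Z Z') (hc : 0 < c)
    {t x : ℝ} (ht : 0 ≤ t) (hx : x ∈ Icc (0:ℝ) 1) :
    HasDerivAt (fun x => profileDensity c φ G Z t x) (profileDensitySpace c φ p G Z Z' t x) x := by
  have hs := nonneg_phase hc ht hx
  have hN : c + φ (c * t + x) ≠ 0 := by have := P.velocity_pos _ hs; positivity
  have h1 : HasDerivAt (fun x => c * t + x) 1 x := (hasDerivAt_id x).const_add (c * t)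
  have h2 := (P.hasDerivAt_invariant (t - G (c * t + x))).comp x
    (((P.hasDerivAt_travel _ hs).comp x h1).const_sub t)
  have h3 := (((P.hasDerivAt_velocity (c * t + x)).comp x h1).const_add c).inv hN
  refine (h2.mul h3).congr_deriv ?_
  simp only [profileDensitySpace, Function.comp_apply, Pi.inv_apply]
  field_simp

theorem isSolCL (P : ClosedLoopProfile c μ ρeq f ρ₀ v₀ φ p G Z Z') (hc : 0 < c)
    (hw : 0 < f ρeq) (hρeq : 0 < ρeq) (hhid : ∀ s ∈ Icc (0:ℝ) (ρmax - ε), h s = s)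
    (heq : ρeq ≤ c / (c + f ρeq) * (ρmax - ε)) :
    IsSolCL c μ ρeq f h (profileDensity c φ G Z) (fun t x => φ (c * t + x))
      (profileDensityTime c φ p G Z Z') (profileDensitySpace c φ p G Z Z')
      (fun t x => c * p (c * t + x)) (fun t x => p (c * t + x)) := by
  have hphase : Continuous fun q : ℝ × ℝ => c * q.1 + q.2 := by fun_prop
  have hp : ContinuousOn (fun q : ℝ × ℝ => p (c * q.1 + q.2)) (Ici 0 ×ˢ Icc 0 1) :=
    (P.locallyLipschitz_velocity.continuous.comp hphase).continuousOn
  have hφ : ContinuousOn (fun q : ℝ × ℝ => φ (c * q.1 + q.2)) (Ici 0 ×ˢ Icc 0 1) :=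
    ((continuous_iff_continuousAt.2 fun s => (P.hasDerivAt_velocity s).continuousAt).comp
      hphase).continuousOn
  have hη : ContinuousOn (fun q : ℝ × ℝ => q.1 - G (c * q.1 + q.2)) (Ici 0 ×ˢ Icc 0 1) :=
    continuousOn_fst.sub ((P.lipschitzOnWith_travel hc).continuousOn.comp hphase.continuousOn
      fun q hq => nonneg_phase hc hq.1 hq.2)
  have hZ : ContinuousOn (fun q : ℝ × ℝ => Z (q.1 - G (c * q.1 + q.2))) (Ici 0 ×ˢ Icc 0 1) :=
    (continuous_iff_continuousAt.2 fun s =>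
      (P.hasDerivAt_invariant s).continuousAt).comp_continuousOn hη
  have hZ' : ContinuousOn (fun q : ℝ × ℝ => Z' (q.1 - G (c * q.1 + q.2))) (Ici 0 ×ˢ Icc 0 1) :=
    P.locallyLipschitz_invariant.continuous.comp_continuousOn hη
  have hN : ContinuousOn (fun q : ℝ × ℝ => (c + φ (c * q.1 + q.2))⁻¹) (Ici 0 ×ˢ Icc 0 1) :=
    (continuousOn_const.add hφ).inv₀ fun q hq =>
      (add_pos hc (P.velocity_pos _ (nonneg_phase hc hq.1 hq.2))).ne'
  refine ⟨hZ.mul hN, hφ, ?_, ?_, continuousOn_const.mul hp, hp, fun t ht x hx => ⟨?_, ?_, ?_, ?_⟩,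
    fun t ht x hx => ⟨?_, sub_self _⟩, fun t ht => ⟨?_, ?_⟩⟩
  · exact ((hZ'.mul (continuousOn_const.sub (hN.mul continuousOn_const))).mul hN).add
      (hZ.mul ((hp.mul continuousOn_const).neg.mul (hN.mul hN)))
  · exact ((hZ'.mul hN.neg).mul hN).add (hZ.mul (hp.neg.mul (hN.mul hN)))
  · exact (P.hasDerivAt_density_time hc ht hx).hasDerivWithinAt
  · exact (P.hasDerivAt_density_space hc ht hx).hasDerivWithinAt
  · have h1 : HasDerivAt (fun t => c * t + x) c t := by
      simpa using ((hasDerivAt_id t).const_mul c).add_const x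
    have h2 := (P.hasDerivAt_velocity (c * t + x)).comp t h1
    rw [mul_comm] at h2
    exact h2.hasDerivWithinAt
  · have h2 := (P.hasDerivAt_velocity (c * t + x)).comp x ((hasDerivAt_id x).const_add (c * t))
    rw [mul_one] at h2
    exact h2.hasDerivWithinAt
  · have := P.velocity_pos _ (nonneg_phase hc ht hx)
    have hinv : (c + φ (c * t + x))⁻¹ * (c + φ (c * t + x)) = 1 :=
      inv_mul_cancel₀ (by positivity)
    simp only [profileDensity, profileDensityTime, profileDensitySpace]
    generalize (c + φ (c * t + x))⁻¹ = a at *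
    linear_combination
      -(Z' (t - G (c * t + x)) * a + Z (t - G (c * t + x)) * p (c * t + x) * a) * hinv
  · have h0 : (0:ℝ) ∈ Icc (0:ℝ) 1 := ⟨le_rfl, zero_le_one⟩
    rw [P.density_inlet hc ht, feedback_flow_eq hc hw hρeq hhid heq
      (P.velocity_pos _ (nonneg_phase hc ht h0))]
  · rw [profileDensity, ← div_eq_mul_inv]
    exact P.outlet t ht

theorem memX (P : ClosedLoopProfile c μ ρeq f ρ₀ v₀ φ p G Z Z') (hc : 0 < c)
    (hw : 0 < f ρeq) (hρeq : 0 < ρeq) (hhid : ∀ s ∈ Icc (0:ℝ) (ρmax - ε), h s = s)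
    (heq : ρeq ≤ c / (c + f ρeq) * (ρmax - ε))
    (hpos : ∀ x ∈ Icc (0:ℝ) 1, 0 < ρ₀ x ∧ 0 < v₀ x) {t : ℝ} (ht : 0 ≤ t) :
    MemX c μ f h (fun x => profileDensity c φ G Z t x) (fun x => φ (c * t + x)) := by
  have h0 : (0:ℝ) ∈ Icc (0:ℝ) 1 := ⟨le_rfl, zero_le_one⟩
  have hcl : ∀ x, clampIcc 0 1 x ∈ Icc (0:ℝ) 1 := clampIcc_mem zero_le_one
  have hσ : LocallyLipschitz fun x => c * t + clampIcc 0 1 x :=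
    (LocallyLipschitz.const _).add (lipschitzWith_clampIcc 0 1).locallyLipschitz
  have hp := P.locallyLipschitz_velocity.comp hσ
  have hφ := (locallyLipschitz_of_hasDerivAt P.hasDerivAt_velocity
    P.locallyLipschitz_velocity.continuous).comp hσ
  have hN := ((LocallyLipschitz.const c).add hφ).real_inv fun x => by
    have := P.velocity_pos _ (nonneg_phase hc ht (hcl x))
    simp only [Function.comp_apply]
    positivity
  have hη : LocallyLipschitz fun x => t - G (c * t + clampIcc 0 1 x) := by
    have hLip : LipschitzWith 1 fun x => c * t + clampIcc 0 1 x := by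
      refine LipschitzWith.of_dist_le_mul fun x y => ?_
      rw [dist_add_left]
      exact (lipschitzWith_clampIcc 0 1).dist_le_mul x y
    have := (P.lipschitzOnWith_travel hc).comp (hLip.lipschitzOnWith (s := univ))
      fun x _ => nonneg_phase hc ht (hcl x)
    rw [lipschitzOnWith_univ] at this
    exact (LocallyLipschitz.const t).sub this.locallyLipschitz
  have hZ := (locallyLipschitz_of_hasDerivAt P.hasDerivAt_invariant
    P.locallyLipschitz_invariant.continuous).comp hη
  have hZ' := P.locallyLipschitz_invariant.comp hη
  have hv0 := P.velocity_pos _ (nonneg_phase hc ht h0)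
  obtain ⟨L₁, hL₁⟩ := (((hZ'.real_mul hN.neg).real_mul hN).add
    (hZ.real_mul (hp.neg.real_mul (hN.real_mul hN)))).exists_lipschitzOnWith_Icc 0 1
  obtain ⟨L₂, hL₂⟩ := hp.exists_lipschitzOnWith_Icc 0 1
  refine ⟨profileDensitySpace c φ p G Z Z' t, fun x => p (c * t + x),
    fun x hx => (P.hasDerivAt_density_space hc ht hx).hasDerivWithinAt, fun x hx => ?_,
    ⟨L₁, fun x hx y hy => ?_⟩, ⟨L₂, fun x hx y hy => ?_⟩,
    fun x hx => ⟨P.density_pos hc hpos ht hx, P.velocity_pos _ (nonneg_phase hc ht hx)⟩, ?_,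
    ρeq * (c + f ρeq) / (c + φ (c * t + 0)), by positivity,
    φ (c * t + 0) * profileDensitySpace c φ p G Z Z' t 0 +
      profileDensity c φ G Z t 0 * p (c * t + 0), ?_, ?_⟩
  · have h2 := (P.hasDerivAt_velocity (c * t + x)).comp x ((hasDerivAt_id x).const_add (c * t))
    rw [mul_one] at h2
    exact h2.hasDerivWithinAt
  · have := hL₁ hx hy
    simpa only [clampIcc_of_mem hx, clampIcc_of_mem hy, Function.comp_apply, Pi.add_apply,
      Pi.neg_apply, profileDensitySpace] using this
  · have := hL₂ hx hy
    simpa only [clampIcc_of_mem hx, clampIcc_of_mem hy, Function.comp_apply] using this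
  · simp only [profileDensity, ← div_eq_mul_inv]
    exact P.outlet t ht
  · exact (P.density_inlet hc ht).trans (hhid _ ⟨by positivity, (inlet_density_lt hc hw hρeq heq hv0).le⟩).symm
  · have ha : 0 < ρeq * (c + f ρeq) / (c + φ (c * t + 0)) := by positivity
    have hb := inlet_density_lt hc hw hρeq heq hv0
    have hd : h =ᶠ[nhds (ρeq * (c + f ρeq) / (c + φ (c * t + 0)))] id := by
      filter_upwards [Ioo_mem_nhds ha hb] with s hs
      exact hhid s ⟨hs.1.le, hs.2.le⟩
    rw [derivWithin_of_mem_nhds (Ici_mem_nhds ha), hd.deriv_eq, deriv_id, mul_one]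

end ClosedLoopProfile

/-- The largest logarithmic deviation of `g` from `a` over `[0,1]`. -/
noncomputable def supLogDev (a : ℝ) (g : ℝ → ℝ) : ℝ :=
  sSup {y : ℝ | ∃ x ∈ Icc (0:ℝ) 1, y = |Real.log (g x / a)|}

theorem supLogDev_le {a B : ℝ} {g : ℝ → ℝ} (h : ∀ x ∈ Icc (0:ℝ) 1, |Real.log (g x / a)| ≤ B) :
    supLogDev a g ≤ B := by
  refine csSup_le ⟨_, 0, ⟨le_rfl, zero_le_one⟩, rfl⟩ ?_
  rintro _ ⟨x, hx, rfl⟩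
  exact h x hx

theorem le_supLogDev {a : ℝ} {g : ℝ → ℝ} (ha : 0 < a) (hg : ContinuousOn g (Icc 0 1))
    (hpos : ∀ x ∈ Icc (0:ℝ) 1, 0 < g x) {x : ℝ} (hx : x ∈ Icc (0:ℝ) 1) :
    |Real.log (g x / a)| ≤ supLogDev a g := by
  refine le_csSup ?_ ⟨x, hx, rfl⟩
  have hcont : ContinuousOn (fun x => |Real.log (g x / a)|) (Icc 0 1) :=
    ((hg.div_const a).log fun x hx => (div_pos (hpos x hx) ha).ne').abs
  obtain ⟨B, hB⟩ := (isCompact_Icc.image_of_continuousOn hcont).bddAbove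
  refine ⟨B, ?_⟩
  rintro _ ⟨y, hy, rfl⟩
  exact hB ⟨y, hy, rfl⟩

theorem abs_log_const_add_div_le {c u w : ℝ} (hc : 0 < c) (hu : 0 < u) (hw : 0 < w) :
    |Real.log ((c + u) / (c + w))| ≤ |Real.log (u / w)| := by
  obtain ⟨h1, h2, -⟩ := abs_sub_le_of_abs_log_le hu hw le_rfl
  set B := |Real.log (u / w)| with hB
  have hB0 : 0 ≤ B := abs_nonneg _
  have hcw : 0 < c + w := by positivity
  have hdiv : 0 < (c + u) / (c + w) := by positivity
  refine abs_le.2 ⟨?_, ?_⟩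
  · rw [Real.le_log_iff_exp_le hdiv, le_div_iff₀ hcw]
    have : Real.exp (-B) ≤ 1 := Real.exp_le_one_iff.2 (by linarith)
    nlinarith
  · rw [Real.log_le_iff_le_exp hdiv, div_le_iff₀ hcw]
    have : 1 ≤ Real.exp B := Real.one_le_exp hB0
    nlinarith

theorem log_mul_const_add_div {c r r' u w : ℝ} (hc : 0 < c) (hr : 0 < r) (hr' : 0 < r')
    (hu : 0 < u) (hw : 0 < w) :
    Real.log (r * (c + u) / (r' * (c + w))) =
      Real.log (r / r') + Real.log ((c + u) / (c + w)) := by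
  rw [mul_div_mul_comm, Real.log_mul (by positivity) (by positivity)]

theorem abs_log_mul_const_add_div_le {c r r' u w : ℝ} (hc : 0 < c) (hr : 0 < r) (hr' : 0 < r')
    (hu : 0 < u) (hw : 0 < w) :
    |Real.log (r * (c + u) / (r' * (c + w)))| ≤ |Real.log (r / r')| + |Real.log (u / w)| := by
  rw [log_mul_const_add_div hc hr hr' hu hw]
  exact (abs_add_le _ _).trans (add_le_add le_rfl (abs_log_const_add_div_le hc hu hw))

theorem abs_log_div_le_mul_const_add {c r r' u w : ℝ} (hc : 0 < c) (hr : 0 < r) (hr' : 0 < r')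
    (hu : 0 < u) (hw : 0 < w) :
    |Real.log (r / r')| ≤ |Real.log (r * (c + u) / (r' * (c + w)))| + |Real.log (u / w)| := by
  rw [eq_sub_of_add_eq (log_mul_const_add_div hc hr hr' hu hw).symm]
  exact (abs_sub _ _).trans (add_le_add le_rfl (abs_log_const_add_div_le hc hu hw))

namespace ClosedLoopProfile

variable {c μ ρeq : ℝ} {f ρ₀ v₀ φ p G Z Z' : ℝ → ℝ}

theorem abs_log_invariant_le (P : ClosedLoopProfile c μ ρeq f ρ₀ v₀ φ p G Z Z') (hc : 0 < c)
    (hw : 0 < f ρeq) (hρeq : 0 < ρeq) (hpos : ∀ x ∈ Icc (0:ℝ) 1, 0 < ρ₀ x ∧ 0 < v₀ x) {m : ℝ}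
    (hm : ∀ x ∈ Icc (0:ℝ) 1, |Real.log (ρ₀ x / ρeq)| + |Real.log (v₀ x / f ρeq)| ≤ m) {η : ℝ}
    (hη : -G 1 ≤ η) : |Real.log (Z η / (ρeq * (c + f ρeq)))| ≤ m := by
  obtain ⟨x, hx, h⟩ := P.exists_invariant_eq hη
  rw [h]
  exact (abs_log_mul_const_add_div_le hc (hpos x hx).1 hρeq (hpos x hx).2 hw).trans (hm x hx)

theorem outletTrajectory (P : ClosedLoopProfile c μ ρeq f ρ₀ v₀ φ p G Z Z') (hc : 0 < c)
    (hw : 0 < f ρeq) (hρeq : 0 < ρeq) (hpos : ∀ x ∈ Icc (0:ℝ) 1, 0 < ρ₀ x ∧ 0 < v₀ x) {m : ℝ}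
    (hm : ∀ x ∈ Icc (0:ℝ) 1, |Real.log (ρ₀ x / ρeq)| + |Real.log (v₀ x / f ρeq)| ≤ m) :
    OutletTrajectory c μ ρeq f m (fun t => φ (c * t + 1)) (fun t => t - G (c * t + 1))
      (fun t => Z (t - G (c * t + 1))) := by
  have h1mem : (1:ℝ) ∈ Icc (0:ℝ) 1 := ⟨zero_le_one, le_rfl⟩
  have hlin : ∀ t, HasDerivAt (fun t : ℝ => c * t + 1) c t := fun t => by
    simpa using ((hasDerivAt_id t).const_mul c).add_const 1
  have hV : ∀ t ≥ 0, 0 < φ (c * t + 1) := fun t ht =>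
    P.velocity_pos _ (nonneg_phase hc ht h1mem)
  refine ⟨fun t ht => ?_, fun t ht => ?_, hV, ?_, ?_,
    fun t ht => P.invariant_pos hc hpos (P.neg_travel_le_label hc ht h1mem),
    fun t ht => P.abs_log_invariant_le hc hw hρeq hpos hm (P.neg_travel_le_label hc ht h1mem),
    fun t _ ht => P.invariant_eq _ ht⟩
  · refine ((P.hasDerivAt_velocity (c * t + 1)).comp t (hlin t)).congr_deriv ?_
    rw [mul_comm]
    exact P.outlet t ht
  · refine ((hasDerivAt_id t).sub ((P.hasDerivAt_travel _ (nonneg_phase hc ht h1mem)).comp t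
      (hlin t))).congr_deriv ?_
    have := hV t ht
    field_simp
    ring
  · simp only [mul_zero, zero_add]
    rw [P.velocity_initial 1 h1mem]
    exact (le_add_of_nonneg_left (abs_nonneg _)).trans (hm 1 h1mem)
  · have := P.travel_le_add hc le_rfl zero_le_one
    rw [P.travel_zero, sub_zero, zero_add] at this
    simp only [mul_zero, zero_add]
    linarith

theorem supLogDev_add_le (P : ClosedLoopProfile c μ ρeq f ρ₀ v₀ φ p G Z Z') (hc : 0 < c)
    (hw : 0 < f ρeq) (hρeq : 0 < ρeq) (hpos : ∀ x ∈ Icc (0:ℝ) 1, 0 < ρ₀ x ∧ 0 < v₀ x)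
    {t A B : ℝ} (ht : 0 ≤ t)
    (hA : ∀ x ∈ Icc (0:ℝ) 1, |Real.log (Z (t - G (c * t + x)) / (ρeq * (c + f ρeq)))| ≤ A)
    (hB : ∀ x ∈ Icc (0:ℝ) 1, |Real.log (φ (c * t + x) / f ρeq)| ≤ B) :
    supLogDev ρeq (fun x => profileDensity c φ G Z t x) +
      supLogDev (f ρeq) (fun x => φ (c * t + x)) ≤ A + B + B := by
  refine add_le_add (supLogDev_le fun x hx => ?_) (supLogDev_le hB)
  refine (abs_log_div_le_mul_const_add hc (P.density_pos hc hpos ht hx) hρeq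
    (P.velocity_pos _ (nonneg_phase hc ht hx)) hw).trans ?_
  rw [P.density_mul hc ht hx]
  exact add_le_add (hA x hx) (hB x hx)

theorem supLogDev_add_le_of_outlet (P : ClosedLoopProfile c μ ρeq f ρ₀ v₀ φ p G Z Z')
    (hc : 0 < c) (hw : 0 < f ρeq) (hρeq : 0 < ρeq)
    (hpos : ∀ x ∈ Icc (0:ℝ) 1, 0 < ρ₀ x ∧ 0 < v₀ x) {m B : ℝ} (hB0 : 0 ≤ B)
    (hm : ∀ x ∈ Icc (0:ℝ) 1, |Real.log (ρ₀ x / ρeq)| + |Real.log (v₀ x / f ρeq)| ≤ m)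
    (hB : ∀ t ≥ 0, |Real.log (φ (c * t + 1) / f ρeq)| ≤ B) {t : ℝ} (ht : 0 ≤ t) :
    supLogDev ρeq (fun x => profileDensity c φ G Z t x) +
      supLogDev (f ρeq) (fun x => φ (c * t + x)) ≤ 3 * m + 2 * B := by
  have hm0 : 0 ≤ m := (by positivity : (0:ℝ) ≤ _).trans (hm 0 ⟨le_rfl, zero_le_one⟩)
  refine (P.supLogDev_add_le hc hw hρeq hpos ht (A := m) (B := m + B)
    (fun x hx => P.abs_log_invariant_le hc hw hρeq hpos hm (P.neg_travel_le_label hc ht hx))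
    fun x hx => ?_).trans (by linarith)
  rcases le_total (c * t + x) 1 with h | h
  · have hmem : c * t + x ∈ Icc (0:ℝ) 1 := ⟨nonneg_phase hc ht hx, h⟩
    rw [P.velocity_initial _ hmem]
    linarith [hm _ hmem, abs_nonneg (Real.log (ρ₀ (c * t + x) / ρeq))]
  · have := hB ((c * t + x - 1) / c) (div_nonneg (by linarith) hc.le)
    rw [mul_div_cancel₀ _ hc.ne', sub_add_cancel] at this
    linarith

theorem supLogDev_add_le_of_outlet_eventually
    (P : ClosedLoopProfile c μ ρeq f ρ₀ v₀ φ p G Z Z')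
    (hc : 0 < c) (hw : 0 < f ρeq) (hρeq : 0 < ρeq)
    (hpos : ∀ x ∈ Icc (0:ℝ) 1, 0 < ρ₀ x ∧ 0 < v₀ x) {e T : ℝ} (hT : 0 ≤ T)
    (he : ∀ t ≥ T, 0 ≤ t - G (c * t + 1) ∧ |Real.log (φ (c * t + 1) / f ρeq)| ≤ e) {t : ℝ}
    (ht : T + 1 / c ≤ t) :
    supLogDev ρeq (fun x => profileDensity c φ G Z t x) +
      supLogDev (f ρeq) (fun x => φ (c * t + x)) ≤ 2 * e := by
  have hc' : 0 < 1 / c := by positivity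
  have ht0 : 0 ≤ t := by linarith
  have key : ∀ x ∈ Icc (0:ℝ) 1, 0 ≤ t - G (c * t + x) ∧
      |Real.log (φ (c * t + x) / f ρeq)| ≤ e := by
    intro x hx
    have hs : c * (t - (1 - x) / c) + 1 = c * t + x := by field_simp; ring
    have hle : (1 - x) / c ≤ 1 / c := div_le_div_of_nonneg_right (by linarith [hx.1]) hc.le
    have h0 : 0 ≤ (1 - x) / c := div_nonneg (by linarith [hx.2]) hc.le
    have := he (t - (1 - x) / c) (by linarith)
    rw [hs] at this
    exact ⟨by linarith, this.2⟩
  refine (P.supLogDev_add_le hc hw hρeq hpos ht0 (A := 0) (fun x hx => ?_)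
    fun x hx => (key x hx).2).trans (by linarith)
  rw [P.invariant_eq _ (key x hx).1, div_self (by positivity), Real.log_one, abs_zero]

end ClosedLoopProfile

theorem exists_isKL_closedLoop {c μ ρeq : ℝ} {f : ℝ → ℝ} (hc : 0 < c) (hμ : 0 < μ)
    (hρeq : 0 < ρeq) (hf1 : ContDiffOn ℝ 1 f (Ici 0)) (hfpos : ∀ x ∈ Ici (0:ℝ), 0 < f x)
    (hfanti : AntitoneOn f (Ici 0))
    (hsign : ∀ v : ℝ, 0 ≤ v → v ≠ f ρeq →
      0 < (v - f (ρeq * (c + f ρeq) / (c + v))) * (v - f ρeq)) :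
    ∃ Q : ℝ → ℝ → ℝ, IsKL Q ∧ ∀ ρ₀ v₀ φ p G Z Z' : ℝ → ℝ,
      ClosedLoopProfile c μ ρeq f ρ₀ v₀ φ p G Z Z' →
      ContinuousOn ρ₀ (Icc 0 1) → ContinuousOn v₀ (Icc 0 1) →
      (∀ x ∈ Icc (0:ℝ) 1, 0 < ρ₀ x ∧ 0 < v₀ x) → ∀ t ≥ 0,
      supLogDev ρeq (fun x => profileDensity c φ G Z t x) +
        supLogDev (f ρeq) (fun x => φ (c * t + x)) ≤
        Q (supLogDev ρeq ρ₀ + supLogDev (f ρeq) v₀) t := by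
  have hw : 0 < f ρeq := hfpos _ hρeq.le
  let D : Set (ℝ × ℝ × ℝ) := {q | 0 ≤ q.2.1 ∧ ∃ ρ₀ v₀ φ p G Z Z' : ℝ → ℝ,
    ClosedLoopProfile c μ ρeq f ρ₀ v₀ φ p G Z Z' ∧
    (∀ x ∈ Icc (0:ℝ) 1, 0 < ρ₀ x ∧ 0 < v₀ x) ∧
    (∀ x ∈ Icc (0:ℝ) 1, |Real.log (ρ₀ x / ρeq)| + |Real.log (v₀ x / f ρeq)| ≤ q.1) ∧
    q.2.2 = supLogDev ρeq (fun x => profileDensity c φ G Z q.2.1 x) +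
      supLogDev (f ρeq) (fun x => φ (c * q.2.1 + x))}
  have hnonneg : ∀ q ∈ D, 0 ≤ q.1 := by
    rintro q ⟨-, ρ₀, v₀, φ, p, G, Z, Z', -, -, hm, -⟩
    exact (by positivity : (0:ℝ) ≤ _).trans (hm 0 ⟨le_rfl, zero_le_one⟩)
  have hbound : ∀ R, ∃ C ≥ 0, ∀ q ∈ D, q.1 ≤ R →
      q.2.2 ≤ 3 * q.1 + 2 * (C * (Real.exp q.1 - 1)) := by
    intro R
    obtain ⟨C, hC, H⟩ := OutletTrajectory.log_bound hc hμ hρeq hf1 hfpos hfanti hsign R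
    refine ⟨C, hC, ?_⟩
    intro q hq hR
    have hq0 := hnonneg q hq
    obtain ⟨ht, ρ₀, v₀, φ, p, G, Z, Z', P, hpos, hm, hN⟩ := hq
    rw [hN]
    exact P.supLogDev_add_le_of_outlet hc hw hρeq hpos
      (mul_nonneg hC (sub_nonneg.2 (Real.one_le_exp hq0))) hm
      (H q.1 hR _ _ _ (P.outletTrajectory hc hw hρeq hpos hm)) ht
  obtain ⟨Q, hQ, hQD⟩ := exists_isKL_of_uniform D hnonneg
    (fun R => by
      obtain ⟨C, hC, H⟩ := hbound R
      refine ⟨3 * R + 2 * (C * (Real.exp R - 1)), fun q hq hR => (H q hq hR).trans ?_⟩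
      gcongr)
    (fun e he => by
      obtain ⟨C, hC, H⟩ := hbound 1
      have hcont : Continuous fun s : ℝ => 3 * s + 2 * (C * (Real.exp s - 1)) := by fun_prop
      have hlim := hcont.tendsto 0
      simp only [Real.exp_zero, sub_self, mul_zero, add_zero] at hlim
      obtain ⟨δ, hδ, hδe⟩ := Metric.eventually_nhds_iff.1 (hlim.eventually (gt_mem_nhds he))
      refine ⟨min 1 (δ / 2), by positivity, fun q hq hle => ?_⟩
      refine (H q hq (hle.trans (min_le_left _ _))).trans (hδe ?_).le
      rw [Real.dist_eq, sub_zero, abs_of_nonneg (hnonneg q hq)]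
      exact (hle.trans (min_le_right _ _)).trans_lt (half_lt_self hδ))
    (fun R e he => by
      obtain ⟨T, hT, H⟩ := OutletTrajectory.attraction hc hμ hρeq hf1 hfpos hfanti hsign R
        (half_pos he)
      refine ⟨T + 1 / c, ?_⟩
      rintro q ⟨ht, ρ₀, v₀, φ, p, G, Z, Z', P, hpos, hm, hN⟩ hR hTq
      rw [hN]
      refine (P.supLogDev_add_le_of_outlet_eventually hc hw hρeq hpos hT
        (H q.1 hR _ _ _ (P.outletTrajectory hc hw hρeq hpos hm)) hTq).trans (by linarith))
  refine ⟨Q, hQ, fun ρ₀ v₀ φ p G Z Z' P hρ hv hpos t ht => ?_⟩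
  exact hQD (_, t, _) ⟨ht, ρ₀, v₀, φ, p, G, Z, Z', P, hpos,
    fun x hx => add_le_add (le_supLogDev hρeq hρ (fun x hx => (hpos x hx).1) hx)
      (le_supLogDev hw hv (fun x hx => (hpos x hx).2) hx), rfl⟩ ht

/-- Theorem 3.1: global asymptotic stabilization, in the sup-norm of the logarithmic
deviations, of an arbitrary equilibrium `(ρeq, f ρeq)` of the traffic flow model by the
inlet-flow boundary feedback `q(t) = ρeq v(t,0) (c + f ρeq)/(c + v(t,0))`. -/
theorem stmt7 (c μ ρmax ε ρeq : ℝ)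
    (hc : 0 < c) (hμ : 0 < μ) (hρmax : 0 < ρmax) (hε : ε ∈ Ioo 0 ρmax) (hρeq : 0 < ρeq)
    (f : ℝ → ℝ) (hf1 : ContDiffOn ℝ 1 f (Ici 0))
    (hfpos : ∀ x ∈ Ici (0:ℝ), 0 < f x)
    (hfbdd : ∃ M, ∀ x ∈ Ici (0:ℝ), f x ≤ M)
    (hfanti : AntitoneOn f (Ici 0))
    (h : ℝ → ℝ) (hh2 : ContDiffOn ℝ 2 h (Ici 0)) (hhmono : MonotoneOn h (Ici 0))
    (hhid : ∀ s ∈ Icc (0:ℝ) (ρmax - ε), h s = s)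
    (hhsat : ∀ s, ρmax ≤ s → h s = ρmax)
    (heq : ρeq ≤ c / (c + f ρeq) * (ρmax - ε))
    (hsign : ∀ v : ℝ, 0 ≤ v → v ≠ f ρeq →
      0 < (v - f (ρeq * (c + f ρeq) / (c + v))) * (v - f ρeq)) :
    ∃ Q : ℝ → ℝ → ℝ, IsKL Q ∧
      ∀ ρ₀ v₀ ρ₀' v₀' : ℝ → ℝ,
        MemX c μ f h ρ₀ v₀ →
        (∀ x ∈ Icc (0:ℝ) 1, HasDerivWithinAt ρ₀ (ρ₀' x) (Icc 0 1) x) →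
        (∀ x ∈ Icc (0:ℝ) 1, HasDerivWithinAt v₀ (v₀' x) (Icc 0 1) x) →
        ρ₀ 0 = ρeq * (c + f ρeq) / (c + v₀ 0) →
        ρ₀' 0 = -(ρ₀ 0 / (c + v₀ 0)) * v₀' 0 →
        ∃ ρ v ρt ρx vt vx : ℝ → ℝ → ℝ,
          IsSolCL c μ ρeq f h ρ v ρt ρx vt vx ∧
          (∀ x ∈ Icc (0:ℝ) 1, ρ 0 x = ρ₀ x ∧ v 0 x = v₀ x) ∧
          (∀ t ∈ Ici (0:ℝ), MemX c μ f h (fun x => ρ t x) (fun x => v t x)) ∧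
          (∀ t ∈ Ici (0:ℝ),
            sSup {y : ℝ | ∃ x ∈ Icc (0:ℝ) 1, y = |Real.log (ρ t x / ρeq)|} +
            sSup {y : ℝ | ∃ x ∈ Icc (0:ℝ) 1, y = |Real.log (v t x / f ρeq)|} ≤
            Q (sSup {y : ℝ | ∃ x ∈ Icc (0:ℝ) 1, y = |Real.log (ρ₀ x / ρeq)|} +
               sSup {y : ℝ | ∃ x ∈ Icc (0:ℝ) 1, y = |Real.log (v₀ x / f ρeq)|}) t) ∧
          (∀ ρ₂ v₂ ρt₂ ρx₂ vt₂ vx₂ : ℝ → ℝ → ℝ,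
            IsSolCL c μ ρeq f h ρ₂ v₂ ρt₂ ρx₂ vt₂ vx₂ →
            (∀ x ∈ Icc (0:ℝ) 1, ρ₂ 0 x = ρ₀ x ∧ v₂ 0 x = v₀ x) →
            ∀ t ∈ Ici (0:ℝ), ∀ x ∈ Icc (0:ℝ) 1,
              ρ₂ t x = ρ t x ∧ v₂ t x = v t x) := by
  have hw : 0 < f ρeq := hfpos _ hρeq.le
  obtain ⟨Q, hQ, hQbound⟩ := exists_isKL_closedLoop hc hμ hρeq hf1 hfpos hfanti hsign
  refine ⟨Q, hQ, fun ρ₀ v₀ ρ₀' v₀' hX hρ₀' hv₀' hρ0 hρ₀der => ?_⟩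
  obtain ⟨φ, p, G, Z, Z', P⟩ :=
    exists_closedLoopProfile hc hμ hw hf1 hfpos hfbdd hX hρ₀' hv₀' hρ0 hρ₀der
  have hpos : ∀ x ∈ Icc (0:ℝ) 1, 0 < ρ₀ x ∧ 0 < v₀ x := by
    obtain ⟨-, -, -, -, -, -, hpos, -⟩ := hX
    exact hpos
  have hinit : ∀ x ∈ Icc (0:ℝ) 1, profileDensity c φ G Z 0 x = ρ₀ x ∧ φ (c * 0 + x) = v₀ x := by
    intro x hx
    have hv := hpos x hx
    simp only [profileDensity, mul_zero, zero_add, zero_sub]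
    rw [P.velocity_initial x hx, P.invariant_initial x hx,
      mul_inv_cancel_right₀ (add_pos hc hv.2).ne']
    exact ⟨rfl, rfl⟩
  have hsol := P.isSolCL hc hw hρeq hhid heq
  refine ⟨_, _, _, _, _, _, hsol, hinit, fun t ht => P.memX hc hw hρeq hhid heq hpos ht,
    fun t ht => hQbound ρ₀ v₀ φ p G Z Z' P (fun x hx => (hρ₀' x hx).continuousWithinAt)
      (fun x hx => (hv₀' x hx).continuousWithinAt) hpos t ht,
    fun ρ₂ v₂ ρt₂ ρx₂ vt₂ vx₂ hsol₂ hinit₂ => ?_⟩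
  have hpos₁ := IsSolCL.pos hc hμ hρeq hfpos hfanti hhid heq hsol fun x hx => by
    rw [(hinit x hx).1, (hinit x hx).2]
    exact hpos x hx
  have hpos₂ := IsSolCL.pos hc hμ hρeq hfpos hfanti hhid heq hsol₂ fun x hx => by
    rw [(hinit₂ x hx).1, (hinit₂ x hx).2]
    exact hpos x hx
  exact IsSolCL.unique hc hμ hρeq hf1 hw hhid heq hsol hsol₂ hpos₁ hpos₂ fun x hx => by
    rw [(hinit x hx).1, (hinit x hx).2]
    exact hinit₂ x hx
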